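/- arXiv:2107.06583 — 4 statements merged into one kernel-verified Lean document; each statement's English description precedes it below -/
import Mathlib

section
/- There exists ε₁ > 0 such that for any 0 < ε₂ < 1/5 and s ≥ 20, there exist d₀ = d₀(ε₁,ε₂,s) and a constant 0 < t₄ < 1/3 such that the following holds for each n ≥ d ≥ d₀ with d < 2·log^s n: if G is an n-vertex TK_{d/2}^(2)-free bipartite (ε₁, ε₂·d)-expander with minimum degree δ(G) ≥ d and maximum degree Δ(G) ≤ d²·log^{10} n, then G contains an ℓ-balanced subdivision TK_k^(ℓ) of the complete graph with k ≥ t₄·d, for some ℓ ∈ ℕ. -/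
open Real

namespace Balanced

variable {V : Type*}

/-- The external neighbourhood of a vertex set `X` in `G`. -/
def extNbr (G : SimpleGraph V) (X : Set V) : Set V := {v | v ∉ X ∧ ∃ u ∈ X, G.Adj u v}

/-- The Komlós–Szemerédi expansion function `ε(x, ε₁, k)`. -/
noncomputable def epsFn (ε₁ k x : ℝ) : ℝ :=
  if x < k / 5 then 0 else ε₁ / (Real.log (15 * x / k)) ^ 2

/-- `G` is an `(ε₁, k)`-expander. -/
def IsExpander (G : SimpleGraph V) (ε₁ k : ℝ) : Prop :=
  ∀ X : Set V, k / 2 ≤ (X.ncard : ℝ) → (X.ncard : ℝ) ≤ (Nat.card V : ℝ) / 2 →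
    epsFn ε₁ k (X.ncard : ℝ) * (X.ncard : ℝ) ≤ ((extNbr G X).ncard : ℝ)

/-- `G` is bipartite. -/
def IsBip (G : SimpleGraph V) : Prop := ∃ f : V → Bool, ∀ u v, G.Adj u v → f u ≠ f v

/-- The average degree `2|E(G)|/|V(G)|` of `G`. -/
noncomputable def avgDeg (G : SimpleGraph V) : ℝ :=
  2 * (Nat.card G.edgeSet : ℝ) / (Nat.card V : ℝ)

/-- The minimum degree of `G` is at least `d`. -/
def MinDegGE (G : SimpleGraph V) (d : ℝ) : Prop :=
  ∀ v : V, d ≤ ((G.neighborSet v).ncard : ℝ)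

/-- The support of a walk, as a set of vertices. -/
def suppSet {G : SimpleGraph V} {a b : V} (w : G.Walk a b) : Set V := {x | x ∈ w.support}

/-- `G` contains an `ℓ`-balanced subdivision `TK_k^(ℓ)` of the complete graph `K_k`:
there are `k` core vertices joined pairwise by internally vertex-disjoint paths of
length exactly `ℓ`, whose internal vertices avoid all core vertices. -/
def ContainsBalSub (G : SimpleGraph V) (k ℓ : ℕ) : Prop :=
  ∃ c : Fin k → V, Function.Injective c ∧
    ∃ P : ∀ i j : Fin k, i < j → G.Walk (c i) (c j),
      (∀ i j (h : i < j), (P i j h).IsPath ∧ (P i j h).length = ℓ) ∧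
      (∀ i j (h : i < j) (q : Fin k), c q ∈ (P i j h).support → q = i ∨ q = j) ∧
      (∀ i j (h : i < j) i' j' (h' : i' < j'), (i, j) ≠ (i', j') →
        ∀ x, x ∈ (P i j h).support → x ∈ (P i' j' h').support →
          (x = c i ∨ x = c j) ∧ (x = c i' ∨ x = c j'))

/-- The subgraph `F` of `G` is a `(D, m)`-expansion of the vertex `v`:
`|V(F)| = D` and every vertex of `F` is at distance at most `m` from `v` in `F`. -/
def IsExpansion (G : SimpleGraph V) (F : G.Subgraph) (v : V) (D m : ℝ) : Prop :=
  ∃ hv : v ∈ F.verts, ((F.verts.ncard : ℝ) = D ∧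
    ∀ u, ∀ hu : u ∈ F.verts, ∃ w : F.coe.Walk ⟨v, hv⟩ ⟨u, hu⟩, (w.length : ℝ) ≤ m)

/-- `G` contains a `(D, m, k)`-adjuster. -/
def HasAdjuster (G : SimpleGraph V) (D m : ℝ) (k : ℕ) : Prop :=
  ∃ (v₁ v₂ : V) (F₁ F₂ : G.Subgraph) (A : Set V),
    Disjoint A F₁.verts ∧ Disjoint A F₂.verts ∧ Disjoint F₁.verts F₂.verts ∧
    IsExpansion G F₁ v₁ D m ∧ IsExpansion G F₂ v₂ D m ∧
    (A.ncard : ℝ) ≤ 10 * m * (k : ℝ) ∧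
    ∃ ℓ : ℕ, ∀ i : ℕ, i ≤ k → ∃ w : G.Walk v₁ v₂, w.IsPath ∧
      w.length = ℓ + 2 * i ∧ ∀ x ∈ w.support, x ∈ A ∪ {v₁, v₂}

open Classical in
/-- `π(u, v, G)` for a connected bipartite graph `G`: `0` if `u = v`, `1` if `u, v`
lie in different classes of the bipartition (equivalently, are joined by an odd walk),
and `2` otherwise. -/
noncomputable def piVal (G : SimpleGraph V) (u v : V) : ℕ :=
  if u = v then 0 else if ∃ w : G.Walk u v, Odd w.length then 1 else 2

/-- The ball of radius `r` around `v` in the subgraph of `G` induced on `S`,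
viewed as a subset of `V`. -/
def ballIn (G : SimpleGraph V) (S : Set V) (v : V) (r : ℕ) : Set V :=
  {u | ∃ w : G.Walk v u, w.length ≤ r ∧ ∀ x ∈ w.support, x ∈ S}

/-- The ball of radius `r` around the set `Y` in the subgraph of `G` induced on `S`. -/
def ballSetIn (G : SimpleGraph V) (S : Set V) (Y : Set V) (r : ℕ) : Set V :=
  {u | ∃ y ∈ Y, ∃ w : G.Walk y u, w.length ≤ r ∧ ∀ x ∈ w.support, x ∈ S}

/-- `P 0, …, P (q-1)` are consecutive shortest paths from `v` in the vertex set `W`: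
each `P i` is a shortest path between its endpoints in the graph induced on
`(W \ ⋃_{j<i} V(P j)) ∪ {v}`. -/
def ConsecSP (G : SimpleGraph V) (v : V) (W : Set V) {q : ℕ}
    (P : Fin q → Σ u : V, G.Walk v u) : Prop :=
  ∀ i : Fin q,
    (∀ x ∈ suppSet (P i).2,
      x ∈ (W \ ⋃ (j : Fin q) (_ : j < i), suppSet (P j).2) ∪ {v}) ∧
    ((P i).2).IsPath ∧
    ∀ w' : G.Walk v (P i).1,
      (∀ x ∈ suppSet w',
        x ∈ (W \ ⋃ (j : Fin q) (_ : j < i), suppSet (P j).2) ∪ {v}) →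
      ((P i).2).length ≤ w'.length

/-- `v` is an end vertex of the path `p`. -/
def IsEnd (G : SimpleGraph V) (v : V) (p : Σ a b : V, G.Walk a b) : Prop :=
  v = p.1 ∨ v = p.2.1

/-- `t` is the subpath `p(v, r)` of `p` of length `r` having `v` as an end vertex. -/
def IsTrunc (G : SimpleGraph V) (r : ℕ) (p : Σ a b : V, G.Walk a b) (v : V)
    (t : Σ u : V, G.Walk v u) : Prop :=
  t.2.length = r ∧ ∃ (c : V) (w' : G.Walk t.1 c),
    (⟨v, c, t.2.append w'⟩ : Σ a b : V, G.Walk a b) = p ∨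
    (⟨v, c, t.2.append w'⟩ : Σ a b : V, G.Walk a b) = ⟨p.2.1, p.1, p.2.2.reverse⟩

/-- The vertices that can be reached from `x` in at most `r` steps without entering `F`. -/
def reach (G : SimpleGraph V) (F : Set V) (x : V) : ℕ → Set V
  | 0 => {x}
  | r + 1 => reach G F x r ∪ (extNbr G (reach G F x r) \ F)

/-- The vertices at distance at most `r` from the set `X`. -/
def nbhd (G : SimpleGraph V) (X : Set V) (r : ℕ) : Set V := ⋃ x ∈ X, reach G ∅ x r

theorem mem_reach_iff {G : SimpleGraph V} {F : Set V} {x u : V} {r : ℕ} :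
    u ∈ reach G F x r ↔
      ∃ w : G.Walk x u, w.length ≤ r ∧ ∀ v ∈ w.support, v = x ∨ v ∉ F := by
  induction r generalizing u with
  | zero =>
    constructor
    · rintro rfl
      exact ⟨SimpleGraph.Walk.nil, by simp, by simp⟩
    · rintro ⟨w, hw, -⟩
      have h0 : w.length = 0 := by omega
      exact (SimpleGraph.Walk.eq_of_length_eq_zero h0).symm
  | succ r ih =>
    constructor
    · rintro (h | ⟨⟨-, z, hz, hzu⟩, huF⟩)
      · obtain ⟨w, hw, hs⟩ := ih.1 h
        exact ⟨w, by omega, hs⟩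
      · obtain ⟨w, hw, hs⟩ := ih.1 hz
        refine ⟨w.concat hzu, by simpa using hw, fun v hv => ?_⟩
        rw [SimpleGraph.Walk.support_concat] at hv
        rcases List.mem_append.1 hv with hv | hv
        · exact hs v hv
        · simp only [List.mem_singleton] at hv
          exact Or.inr (hv ▸ huF)
    · rintro ⟨w, hw, hs⟩
      by_cases hlt : w.length ≤ r
      · exact Or.inl (ih.2 ⟨w, hlt, hs⟩)
      by_cases hu : u ∈ reach G F x r
      · exact Or.inl hu
      have hlen : w.length = r + 1 := by omega
      have hmem : w.getVert r ∈ reach G F x r := by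
        refine ih.2 ⟨w.take r, by simp, fun v hv => hs v ?_⟩
        rw [SimpleGraph.Walk.support_take] at hv
        exact List.mem_of_mem_take hv
      have hadj : G.Adj (w.getVert r) u := by
        have := w.adj_getVert_succ (i := r) (by omega)
        rwa [← hlen, w.getVert_length] at this
      have hux : u ≠ x := by
        rintro rfl
        exact hu (ih.2 ⟨SimpleGraph.Walk.nil, by simp, by simp⟩)
      exact Or.inr ⟨⟨hu, _, hmem, hadj⟩, (hs u w.end_mem_support).resolve_left hux⟩

theorem self_mem_reach {G : SimpleGraph V} {F : Set V} {x : V} {r : ℕ} : x ∈ reach G F x r :=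
  mem_reach_iff.2 ⟨SimpleGraph.Walk.nil, by simp, by simp⟩

theorem reach_mono {G : SimpleGraph V} {F : Set V} {x : V} {r s : ℕ} (h : r ≤ s) :
    reach G F x r ⊆ reach G F x s := by
  intro u hu
  obtain ⟨w, hw, hs⟩ := mem_reach_iff.1 hu
  exact mem_reach_iff.2 ⟨w, by omega, hs⟩

theorem reach_anti {G : SimpleGraph V} {F F' : Set V} {x : V} {r : ℕ} (h : F ⊆ F') :
    reach G F' x r ⊆ reach G F x r := by
  intro u hu
  obtain ⟨w, hw, hs⟩ := mem_reach_iff.1 hu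
  exact mem_reach_iff.2 ⟨w, hw, fun v hv => (hs v hv).imp_right fun h' h'' => h' (h h'')⟩

theorem mem_reach_empty {G : SimpleGraph V} {x u : V} {r : ℕ} :
    u ∈ reach G ∅ x r ↔ ∃ w : G.Walk x u, w.length ≤ r := by
  rw [mem_reach_iff]
  simp

theorem mem_reach_empty_of_mem {G : SimpleGraph V} {F : Set V} {x u : V} {r s : ℕ}
    (h : u ∈ reach G F x r) (hrs : r ≤ s) : u ∈ reach G ∅ x s :=
  reach_mono hrs (reach_anti (Set.empty_subset F) h)

theorem reach_empty_symm {G : SimpleGraph V} {x u : V} {r : ℕ} (h : u ∈ reach G ∅ x r) :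
    x ∈ reach G ∅ u r := by
  obtain ⟨w, hw⟩ := mem_reach_empty.1 h
  exact mem_reach_empty.2 ⟨w.reverse, by simpa using hw⟩

theorem reach_empty_trans {G : SimpleGraph V} {x y z : V} {r s : ℕ} (h : y ∈ reach G ∅ x r)
    (h' : z ∈ reach G ∅ y s) : z ∈ reach G ∅ x (r + s) := by
  obtain ⟨w, hw⟩ := mem_reach_empty.1 h
  obtain ⟨w', hw'⟩ := mem_reach_empty.1 h'
  exact mem_reach_empty.2 ⟨w.append w', by rw [SimpleGraph.Walk.length_append]; omega⟩

theorem extNbr_reach_subset {G : SimpleGraph V} {F : Set V} {x : V} {r : ℕ} :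
    extNbr G (reach G F x r) ⊆ reach G ∅ x (r + 1) := by
  rintro u ⟨-, z, hz, hzu⟩
  refine reach_empty_trans (mem_reach_empty_of_mem hz le_rfl) (mem_reach_empty.2 ?_)
  exact ⟨hzu.toWalk, by simp⟩

theorem mem_nbhd {G : SimpleGraph V} {X : Set V} {r : ℕ} {u : V} :
    u ∈ nbhd G X r ↔ ∃ x ∈ X, u ∈ reach G ∅ x r := by
  simp [nbhd]

theorem subset_nbhd {G : SimpleGraph V} {X : Set V} {r : ℕ} : X ⊆ nbhd G X r :=
  fun x hx => mem_nbhd.2 ⟨x, hx, self_mem_reach⟩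

theorem nbhd_mono {G : SimpleGraph V} {X Y : Set V} {r s : ℕ} (h : X ⊆ Y) (hrs : r ≤ s) :
    nbhd G X r ⊆ nbhd G Y s := by
  intro u hu
  obtain ⟨x, hx, hxu⟩ := mem_nbhd.1 hu
  exact mem_nbhd.2 ⟨x, h hx, reach_mono hrs hxu⟩

theorem mem_nbhd_trans {G : SimpleGraph V} {X : Set V} {r s : ℕ} {u v : V}
    (hu : u ∈ nbhd G X r) (hv : v ∈ reach G ∅ u s) : v ∈ nbhd G X (r + s) := by
  obtain ⟨x, hx, hxu⟩ := mem_nbhd.1 hu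
  exact mem_nbhd.2 ⟨x, hx, reach_empty_trans hxu hv⟩

theorem ncard_biUnion_le_mul [Finite V] (X : Set V) (f : V → Set V) (D : ℕ)
    (h : ∀ x ∈ X, (f x).ncard ≤ D) : (⋃ x ∈ X, f x).ncard ≤ X.ncard * D := by
  have hX := X.toFinite
  have h1 := hX.toFinset.set_ncard_biUnion_le f
  simp only [Set.Finite.mem_toFinset] at h1
  refine h1.trans ((Finset.sum_le_card_nsmul _ _ D fun x hx => h x (by simpa using hx)).trans ?_)
  rw [smul_eq_mul, ← Set.ncard_eq_toFinset_card X hX]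

theorem ncard_reach_le [Finite V] {G : SimpleGraph V} {D : ℕ}
    (hD : ∀ v, (G.neighborSet v).ncard + 1 ≤ D) (F : Set V) (x : V) (r : ℕ) :
    (reach G F x r).ncard ≤ D ^ r := by
  induction r with
  | zero => simp [reach]
  | succ r ih =>
    have hsub : reach G F x (r + 1) ⊆ ⋃ v ∈ reach G F x r, insert v (G.neighborSet v) := by
      rintro u (hu | ⟨⟨-, z, hz, hzu⟩, -⟩)
      · exact Set.mem_biUnion hu (Set.mem_insert _ _)
      · exact Set.mem_biUnion hz (Set.mem_insert_of_mem _ hzu)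
    refine (Set.ncard_le_ncard hsub).trans ((ncard_biUnion_le_mul _ _ D fun v _ => ?_).trans ?_)
    · exact (Set.ncard_insert_le _ _).trans (hD v)
    · rw [pow_succ]
      exact Nat.mul_le_mul_right _ ih

theorem ncard_nbhd_le [Finite V] {G : SimpleGraph V} {D : ℕ}
    (hD : ∀ v, (G.neighborSet v).ncard + 1 ≤ D) (X : Set V) (r : ℕ) :
    (nbhd G X r).ncard ≤ X.ncard * D ^ r :=
  ncard_biUnion_le_mul X _ _ fun x _ => ncard_reach_le hD ∅ x r

theorem ncard_reach_succ [Finite V] (G : SimpleGraph V) (F : Set V) (x : V) (r : ℕ) :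
    (reach G F x (r + 1)).ncard + (extNbr G (reach G F x r) ∩ F).ncard =
      (reach G F x r).ncard + (extNbr G (reach G F x r)).ncard := by
  have hdisj : Disjoint (reach G F x r) (extNbr G (reach G F x r) \ F) :=
    Set.disjoint_left.2 fun u hu hu' => hu'.1.1 hu
  have h1 : (reach G F x (r + 1)).ncard =
      (reach G F x r).ncard + (extNbr G (reach G F x r) \ F).ncard :=
    Set.ncard_union_eq hdisj
  have h2 := Set.ncard_inter_add_ncard_sdiff_eq_ncard (extNbr G (reach G F x r)) F
  omega

/-- The logarithmic size that measures the growth of a set in an expander. -/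
theorem log_growth {l b b' k : ℝ} (hl : l = Real.log (15 * b / k)) (hl3 : 3 ≤ l) (hk : 0 < k)
    (hb : 0 < b) (hb' : b * (1 + 2 / l ^ 2) ≤ b') :
    l ≤ Real.log (15 * b' / k) ∧ l ^ 3 + 1 ≤ Real.log (15 * b' / k) ^ 3 := by
  have hl0 : 0 < l := by linarith
  have hu0 : 0 < 2 / l ^ 2 := by positivity
  have hu1 : 2 / l ^ 2 ≤ 1 := by
    rw [div_le_one (by positivity)]; nlinarith
  set u := 2 / l ^ 2 with hu
  have hlog : Real.log (15 * b / k) + Real.log (1 + u) ≤ Real.log (15 * b' / k) := by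
    rw [← Real.log_mul (by positivity) (by positivity)]
    apply Real.log_le_log (by positivity)
    rw [div_mul_eq_mul_div, mul_assoc]
    gcongr
  have hlow : u / 2 ≤ Real.log (1 + u) := by
    have h := Real.one_sub_inv_le_log_of_pos (x := 1 + u) (by linarith)
    have : u / 2 ≤ 1 - (1 + u)⁻¹ := by
      have h1 : 1 - (1 + u)⁻¹ = u / (1 + u) := by field_simp; ring
      rw [h1]
      gcongr
      linarith
    linarith
  have hstep : l + 1 / l ^ 2 ≤ Real.log (15 * b' / k) := by
    have : u / 2 = 1 / l ^ 2 := by rw [hu]; ring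
    rw [hl] at *
    linarith
  have hp : 0 < 1 / l ^ 2 := by positivity
  refine ⟨by linarith, ?_⟩
  have hc : (l + 1 / l ^ 2) ^ 3 ≤ Real.log (15 * b' / k) ^ 3 := by gcongr
  have he : l ^ 3 + 3 ≤ (l + 1 / l ^ 2) ^ 3 := by
    have h1 : l ^ 2 * (1 / l ^ 2) = 1 := by field_simp
    set q := 1 / l ^ 2
    have : (l + q) ^ 3 = l ^ 3 + 3 * (l ^ 2 * q) + 3 * l * q ^ 2 + q ^ 3 := by ring
    rw [this, h1]
    have : 0 ≤ 3 * l * q ^ 2 + q ^ 3 := by positivity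
    linarith
  linarith

theorem exp_bound_linear {l : ℝ} (hl3 : 3 ≤ l) : l ^ 2 * (l ^ 3 + 1) ≤ 240 * Real.exp l := by
  have h := Real.pow_div_factorial_le_exp l (by linarith) 5
  norm_num [Nat.factorial] at h
  nlinarith [pow_pos (by linarith : (0 : ℝ) < l) 2, pow_le_pow_left₀ (by norm_num) hl3 3]

theorem exp_bound_half {l : ℝ} (hl3 : 3 ≤ l) :
    l ^ 2 * Real.exp (l / 2) ≤ 8 * Real.exp l := by
  have h := Real.pow_div_factorial_le_exp (l / 2) (by linarith) 2
  norm_num [Nat.factorial] at h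
  have he : Real.exp l = Real.exp (l / 2) * Real.exp (l / 2) := by
    rw [← Real.exp_add]; ring_nf
  rw [he]
  nlinarith [Real.exp_pos (l / 2)]

theorem exp_three_le : Real.exp 3 ≤ 37 := by
  have h := Real.exp_one_lt_d9
  have : Real.exp 3 = Real.exp 1 ^ 3 := by rw [← Real.exp_nat_mul]; norm_num
  rw [this]
  calc Real.exp 1 ^ 3 ≤ 3 ^ 3 := by gcongr; linarith
    _ ≤ 37 := by norm_num

theorem reach_growth [Finite V] {G : SimpleGraph V} {ε d : ℝ} (hε : 0 < ε) (hε5 : ε < 1 / 5)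
    (hd : 60 ≤ ε * d) (hexp : IsExpander G 4 (ε * d)) (hmin : MinDegGE G d) {F : Set V} {x : V}
    (hF : ∀ r : ℕ,
      ((extNbr G (reach G F x r) ∩ F).ncard : ℝ) ≤ ε / 1800 * d * (r + 1) ∨
      (2 * Real.log ((extNbr G (reach G F x r) ∩ F).ncard : ℝ)) ^ 3 ≤ r)
    (r : ℕ) :
    (Nat.card V : ℝ) / 2 < (reach G F x (r + 1)).ncard ∨
      (3 ≤ Real.log (15 * (reach G F x (r + 1)).ncard / (ε * d)) ∧
        (r + 1 : ℝ) ≤ Real.log (15 * (reach G F x (r + 1)).ncard / (ε * d)) ^ 3) := by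
  have hd0 : 0 < d := by
    by_contra h
    push Not at h
    nlinarith
  induction r with
  | zero =>
    right
    have hc : ((extNbr G (reach G F x 0) ∩ F).ncard : ℝ) ≤ d / 2 := by
      rcases hF 0 with h | h
      · simp only [Nat.cast_zero, zero_add, mul_one] at h
        nlinarith
      · have hd2 : 2 ≤ d := by nlinarith
        have h0 : Real.log ((extNbr G (reach G F x 0) ∩ F).ncard : ℝ) ≤ 0 := by
          by_contra hpos
          push Not at hpos
          have : 0 < (2 * Real.log ((extNbr G (reach G F x 0) ∩ F).ncard : ℝ)) ^ 3 := by positivity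
          simp only [Nat.cast_zero] at h
          linarith
        by_contra hgt
        push Not at hgt
        have := Real.log_pos (x := ((extNbr G (reach G F x 0) ∩ F).ncard : ℝ))
        rcases le_or_gt ((extNbr G (reach G F x 0) ∩ F).ncard : ℝ) 1 with h1 | h1
        · linarith
        · linarith [this h1]
    have hN : d ≤ ((extNbr G (reach G F x 0)).ncard : ℝ) := by
      have : G.neighborSet x ⊆ extNbr G (reach G F x 0) := by
        intro u hu
        exact ⟨fun h => G.ne_of_adj hu (by simpa [reach] using h.symm), x, rfl, hu⟩
      exact (hmin x).trans (by exact_mod_cast Set.ncard_le_ncard this)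
    have hs := ncard_reach_succ G F x 0
    have hs' : ((reach G F x (0 + 1)).ncard : ℝ) + ((extNbr G (reach G F x 0) ∩ F).ncard : ℝ) =
      ((reach G F x 0).ncard : ℝ) + ((extNbr G (reach G F x 0)).ncard : ℝ) := by
        exact_mod_cast hs
    have h0 : (0 : ℝ) ≤ ((reach G F x 0).ncard : ℝ) := by positivity
    have hb : d / 2 ≤ ((reach G F x (0 + 1)).ncard : ℝ) := by linarith
    have h37 : 37 ≤ 15 * ((reach G F x (0 + 1)).ncard : ℝ) / (ε * d) := by
      rw [le_div_iff₀ (by positivity)]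
      nlinarith
    have h3 : 3 ≤ Real.log (15 * ((reach G F x (0 + 1)).ncard : ℝ) / (ε * d)) := by
      rw [Real.le_log_iff_exp_le (by linarith)]
      exact exp_three_le.trans h37
    refine ⟨h3, ?_⟩
    have := pow_le_pow_left₀ (by norm_num) h3 3
    norm_num at this ⊢
    linarith
  | succ r ih =>
    have hmono : ((reach G F x (r + 1)).ncard : ℝ) ≤ ((reach G F x (r + 1 + 1)).ncard : ℝ) := by
      exact_mod_cast Set.ncard_le_ncard
        (reach_mono (G := G) (F := F) (x := x) (Nat.le_succ (r + 1)))
    rcases ih with h | ⟨h3, hr⟩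
    · exact Or.inl (h.trans_le hmono)
    by_cases hbig : (Nat.card V : ℝ) / 2 < (reach G F x (r + 1)).ncard
    · exact Or.inl (hbig.trans_le hmono)
    push Not at hbig
    right
    set b : ℝ := ((reach G F x (r + 1)).ncard : ℝ) with hb
    set l := Real.log (15 * b / (ε * d)) with hl
    set c : ℝ := ((extNbr G (reach G F x (r + 1)) ∩ F).ncard : ℝ) with hc
    have hk : 0 < ε * d := by linarith
    have hb0 : 0 < b := by
      have : 0 < (reach G F x (r + 1)).ncard := (Set.ncard_pos).2 ⟨x, self_mem_reach⟩
      rw [hb]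
      exact_mod_cast this
    have hel : Real.exp l = 15 * b / (ε * d) := Real.exp_log (by positivity)
    have hbe : b = ε * d * Real.exp l / 15 := by rw [hel]; field_simp
    have hexpl : 1 ≤ Real.exp l := Real.one_le_exp (by linarith)
    have hkb : ε * d ≤ b := by
      have h20 : 15 ≤ Real.exp l := by
        have h1 : Real.exp 3 ≤ Real.exp l := Real.exp_le_exp.2 h3
        have h2 := Real.pow_div_factorial_le_exp l (by linarith) 3
        have h4 := Real.pow_div_factorial_le_exp l (by linarith) 2
        have h5 := Real.exp_one_gt_d9
        have : Real.exp 3 = Real.exp 1 ^ 3 := by rw [← Real.exp_nat_mul]; norm_num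
        rw [this] at h1
        have : (2.7 : ℝ) ^ 3 ≤ Real.exp 1 ^ 3 := by gcongr; linarith
        norm_num at this
        linarith
      rw [hbe, le_div_iff₀ (by norm_num)]
      nlinarith
    have hex := hexp (reach G F x (r + 1)) (by linarith) hbig
    have hfn : epsFn 4 (ε * d) b = 4 / l ^ 2 := by
      rw [epsFn, if_neg (by push Not; linarith)]
    rw [← hb, hfn] at hex
    have hl0 : 0 < l := by linarith
    have hcb : c ≤ 2 / l ^ 2 * b := by
      rw [div_mul_eq_mul_div, le_div_iff₀ (by positivity)]
      rcases hF (r + 1) with h | h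
      · rw [← hc] at h
        push_cast at h hr
        have h1 : c ≤ ε / 1800 * d * (l ^ 3 + 1) := by
          refine h.trans ?_
          gcongr
        have h2 := exp_bound_linear h3
        calc c * l ^ 2 ≤ ε / 1800 * d * (l ^ 3 + 1) * l ^ 2 := by gcongr
          _ = ε * d / 1800 * (l ^ 2 * (l ^ 3 + 1)) := by ring
          _ ≤ ε * d / 1800 * (240 * Real.exp l) := by gcongr
          _ = 2 * b := by rw [hbe]; ring
      · rw [← hc] at h
        push_cast at h hr
        rcases eq_or_lt_of_le (show 0 ≤ c by positivity) with h0 | h0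
        · rw [← h0]
          simp only [zero_mul]
          positivity
        have h1 : (2 * Real.log c) ^ 3 ≤ l ^ 3 := h.trans hr
        have h2 : 2 * Real.log c ≤ l := by
          by_contra hlt
          push Not at hlt
          exact absurd (pow_lt_pow_left₀ hlt hl0.le (by norm_num : (3 : ℕ) ≠ 0)) (not_lt.2 h1)
        have h4 : c ≤ Real.exp (l / 2) := by
          rw [← Real.log_le_iff_le_exp h0]
          linarith
        have h5 := exp_bound_half h3
        calc c * l ^ 2 ≤ Real.exp (l / 2) * l ^ 2 := by gcongr
          _ ≤ 8 * Real.exp l := by linarith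
          _ ≤ 2 * b := by rw [hbe]; nlinarith
    have hs : ((reach G F x (r + 1 + 1)).ncard : ℝ) + c =
        b + ((extNbr G (reach G F x (r + 1))).ncard : ℝ) := by
      rw [hb, hc]
      exact_mod_cast ncard_reach_succ G F x (r + 1)
    have hb' : b * (1 + 2 / l ^ 2) ≤ ((reach G F x (r + 1 + 1)).ncard : ℝ) := by
      have : 4 / l ^ 2 * b = 2 / l ^ 2 * b + 2 / l ^ 2 * b := by ring
      nlinarith
    obtain ⟨h1, h2⟩ := log_growth hl h3 hk hb0 hb'
    refine ⟨h3.trans h1, ?_⟩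
    push_cast at hr ⊢
    linarith

/-- A vertex set that leaves few blocked vertices on the boundary of each ball around `x`
does not prevent the ball from growing to more than half of the graph. -/
theorem half_lt_ncard_reach [Finite V] {G : SimpleGraph V} {ε d : ℝ} (hε : 0 < ε)
    (hε5 : ε < 1 / 5) (hd : 60 ≤ ε * d) (hexp : IsExpander G 4 (ε * d)) (hmin : MinDegGE G d)
    {F : Set V} {x : V}
    (hF : ∀ r : ℕ,
      ((extNbr G (reach G F x r) ∩ F).ncard : ℝ) ≤ ε / 1800 * d * (r + 1) ∨
      (2 * Real.log ((extNbr G (reach G F x r) ∩ F).ncard : ℝ)) ^ 3 ≤ r)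
    {M : ℕ} (hM : Real.log (Nat.card V : ℝ) ^ 3 < M) :
    (Nat.card V : ℝ) / 2 < (reach G F x M).ncard := by
  have hn : 0 < Nat.card V := Nat.card_pos_iff.2 ⟨⟨x⟩, inferInstance⟩
  have hlogn : 0 ≤ Real.log (Nat.card V : ℝ) := Real.log_natCast_nonneg _
  obtain ⟨r, rfl⟩ : ∃ r, M = r + 1 := by
    refine Nat.exists_eq_succ_of_ne_zero ?_
    rintro rfl
    have : 0 ≤ Real.log (Nat.card V : ℝ) ^ 3 := by positivity
    push_cast at hM
    linarith
  refine (reach_growth hε hε5 hd hexp hmin hF r).resolve_right ?_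
  rintro ⟨h3, hr⟩
  have hb : ((reach G F x (r + 1)).ncard : ℝ) ≤ Nat.card V := by
    exact_mod_cast Set.ncard_le_card _
  have hb0 : (0 : ℝ) < (reach G F x (r + 1)).ncard := by
    have : 0 < (reach G F x (r + 1)).ncard := (Set.ncard_pos).2 ⟨x, self_mem_reach⟩
    exact_mod_cast this
  have hle : Real.log (15 * (reach G F x (r + 1)).ncard / (ε * d)) ≤ Real.log (Nat.card V : ℝ) := by
    apply Real.log_le_log
    · positivity
    · rw [div_le_iff₀ (by linarith)]
      nlinarith
  have := pow_le_pow_left₀ (by linarith) hle 3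
  push_cast at hM
  linarith

/-- The standing assumptions on an expander with parameters `ε`, `d`, together with a radius `M`
exceeding the cube of the logarithm of its order and a bound `D` on its degrees. -/
structure Ambient [Finite V] (G : SimpleGraph V) (ε d : ℝ) (M D : ℕ) : Prop where
  eps_pos : 0 < ε
  eps_lt : ε < 1 / 5
  le_mul : 60 ≤ ε * d
  expander : IsExpander G 4 (ε * d)
  minDeg : MinDegGE G d
  log_lt : Real.log (Nat.card V : ℝ) ^ 3 < M
  deg_lt : ∀ v, (G.neighborSet v).ncard + 1 ≤ D

/-- For every `r < R`, at most `q * (r + 1)` vertices of `U` lie on the boundary of the ball of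
radius `r` around `x` avoiding `U`. -/
def Thin (G : SimpleGraph V) (U : Set V) (x : V) (R q : ℕ) : Prop :=
  ∀ r < R, (extNbr G (reach G U x r) ∩ U).ncard ≤ q * (r + 1)

theorem Thin.mono {G : SimpleGraph V} {U : Set V} {x : V} {R q q' : ℕ} (h : Thin G U x R q)
    (hq : q ≤ q') : Thin G U x R q' :=
  fun r hr => (h r hr).trans (Nat.mul_le_mul_right _ hq)

theorem reach_congr {G : SimpleGraph V} {U F : Set V} {x : V} {R : ℕ} (hUF : U ⊆ F)
    (h : ∀ v ∈ F, v ∈ reach G ∅ x R → v ∈ U) {r : ℕ} (hr : r ≤ R) :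
    reach G F x r = reach G U x r := by
  refine (reach_anti hUF).antisymm fun u hu => ?_
  obtain ⟨w, hw, hs⟩ := mem_reach_iff.1 hu
  refine mem_reach_iff.2 ⟨w, hw, fun v hv => (hs v hv).imp_right fun h' h'' => h' (h v h'' ?_)⟩
  obtain ⟨n, rfl, hn⟩ := SimpleGraph.Walk.mem_support_iff_exists_getVert.1 hv
  exact mem_reach_empty.2 ⟨w.take n, by rw [SimpleGraph.Walk.take_length]; omega⟩

theorem extNbr_inter_congr {G : SimpleGraph V} {U F : Set V} {x : V} {R : ℕ} (hUF : U ⊆ F)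
    (h : ∀ v ∈ F, v ∈ reach G ∅ x R → v ∈ U) {r : ℕ} (hr : r < R) :
    extNbr G (reach G F x r) ∩ F = extNbr G (reach G U x r) ∩ U := by
  rw [reach_congr hUF h hr.le]
  ext v
  refine ⟨fun hv => ⟨hv.1, h v hv.2 (reach_mono (by omega) (extNbr_reach_subset hv.1))⟩,
    fun hv => ⟨hv.1, hUF hv.2⟩⟩

theorem Thin.of_far {G : SimpleGraph V} {U U' : Set V} {x : V} {R q : ℕ} (h : Thin G U x R q)
    (hU : U ⊆ U') (hfar : ∀ v ∈ U', v ∈ reach G ∅ x R → v ∈ U) : Thin G U' x R q := by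
  intro r hr
  rw [extNbr_inter_congr hU hfar hr]
  exact h r hr

theorem half_lt_ncard_reach_of_thin [Finite V] {G : SimpleGraph V} {ε d : ℝ} {M D : ℕ}
    (hA : Ambient G ε d M D) {U F : Set V} {x : V} {R₁ R₂ N₁ N₂ q : ℕ} (hUF : U ⊆ F)
    (hU : U.ncard ≤ N₁) (hF : F.ncard ≤ N₂) (hq : (q : ℝ) ≤ ε / 1800 * d)
    (hthin : Thin G U x R₁ q) (hfar : ∀ v ∈ F, v ∈ reach G ∅ x R₂ → v ∈ U)
    (h₁ : (2 * Real.log N₁) ^ 3 ≤ R₁) (h₂ : (2 * Real.log N₂) ^ 3 ≤ R₂) :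
    (Nat.card V : ℝ) / 2 < (reach G F x M).ncard := by
  refine half_lt_ncard_reach hA.eps_pos hA.eps_lt hA.le_mul hA.expander hA.minDeg (fun r => ?_)
    hA.log_lt
  have key : ∀ {X Y : Set V} {N R : ℕ}, X ⊆ Y → Y.ncard ≤ N → (2 * Real.log N) ^ 3 ≤ R → R ≤ r →
      (2 * Real.log (X.ncard : ℝ)) ^ 3 ≤ r := by
    intro X Y N R hXY hY hN hR
    have hRr : (R : ℝ) ≤ r := by exact_mod_cast hR
    refine le_trans ?_ (hN.trans hRr)
    rcases Nat.eq_zero_or_pos X.ncard with h0 | h0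
    · rw [h0]
      have := Real.log_natCast_nonneg N
      have h3 : 0 ≤ (2 * Real.log N) ^ 3 := by positivity
      simpa using h3
    · have h1 : (X.ncard : ℝ) ≤ N := by exact_mod_cast (Set.ncard_le_ncard hXY).trans hY
      have h2 := Real.log_le_log (by exact_mod_cast h0) h1
      have h3 := Real.log_natCast_nonneg X.ncard
      gcongr
  by_cases hr2 : r < R₂
  · rw [extNbr_inter_congr hUF hfar hr2]
    by_cases hr1 : r < R₁
    · left
      have h := hthin r hr1
      have h' : ((extNbr G (reach G U x r) ∩ U).ncard : ℝ) ≤ q * (r + 1) := by exact_mod_cast h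
      refine h'.trans ?_
      gcongr
    · exact Or.inr (key Set.inter_subset_right hU h₁ (by omega))
  · exact Or.inr (key Set.inter_subset_right hF h₂ (by omega))

theorem exists_shortest_path [Finite V] {G : SimpleGraph V} {F T : Set V} {cur t₀ : V} {M : ℕ}
    (ht₀ : t₀ ∈ T) (hcur : (Nat.card V : ℝ) / 2 < (reach G F cur M).ncard)
    (hbig : (Nat.card V : ℝ) / 2 < (reach G F t₀ M).ncard) :
    ∃ t ∈ T, ∃ P : G.Walk cur t, P.IsPath ∧ P.length ≤ 2 * M ∧
      (∀ v ∈ P.support, v = cur ∨ v = t ∨ v ∉ F) ∧ (∀ v ∈ P.support, v ∈ T → v = t) ∧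
      (∀ j ≤ P.length, ∀ r, P.getVert j ∈ reach G F cur r → j ≤ r) ∧
      (∀ j ≤ P.length, ∀ t' ∈ T, ∀ r, P.getVert j ∈ reach G F t' r → P.length ≤ j + r) := by
  classical
  let Q : ℕ → Prop := fun L => ∃ t ∈ T, ∃ P : G.Walk cur t, P.length = L ∧
    ∀ v ∈ P.support, v = cur ∨ v ∈ T ∨ v ∉ F
  have hex : ∃ L, L ≤ 2 * M ∧ Q L := by
    obtain ⟨u, hu1, hu2⟩ : (reach G F cur M ∩ reach G F t₀ M).Nonempty := by
      by_contra hne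
      rw [Set.not_nonempty_iff_eq_empty, ← Set.disjoint_iff_inter_eq_empty] at hne
      have h1 := Set.ncard_union_eq hne
      have h2 := Set.ncard_le_card (reach G F cur M ∪ reach G F t₀ M)
      have h3 : ((reach G F cur M).ncard : ℝ) + ((reach G F t₀ M).ncard : ℝ) ≤ Nat.card V := by
        exact_mod_cast h1 ▸ h2
      linarith
    obtain ⟨w1, hw1, hs1⟩ := mem_reach_iff.1 hu1
    obtain ⟨w2, hw2, hs2⟩ := mem_reach_iff.1 hu2
    refine ⟨_, ?_, t₀, ht₀, w1.append w2.reverse, rfl, fun v hv => ?_⟩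
    · rw [SimpleGraph.Walk.length_append, SimpleGraph.Walk.length_reverse]
      omega
    · rw [SimpleGraph.Walk.mem_support_append_iff, SimpleGraph.Walk.support_reverse,
        List.mem_reverse] at hv
      rcases hv with hv | hv
      · rcases hs1 v hv with h | h <;> tauto
      · rcases hs2 v hv with rfl | h <;> tauto
  obtain ⟨L₀, hL₀, hQ₀⟩ := hex
  have hQ : ∃ L, Q L := ⟨L₀, hQ₀⟩
  obtain ⟨t, ht, P, hP, hPs⟩ := Nat.find_spec hQ
  have hmin : ∀ {t'} (_ : t' ∈ T) (w : G.Walk cur t'),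
      (∀ v ∈ w.support, v = cur ∨ v ∈ T ∨ v ∉ F) → P.length ≤ w.length := by
    intro t' ht' w hw
    rw [hP]
    exact Nat.find_min' hQ ⟨t', ht', w, rfl, hw⟩
  have hPath : P.IsPath := by
    have hle : P.length ≤ P.bypass.length :=
      hmin ht P.bypass fun v hv => hPs v (P.support_bypass_subset_support hv)
    exact P.bypass_eq_self_of_length_le_length_bypass hle ▸ P.bypass_isPath
  have hT : ∀ v ∈ P.support, v ∈ T → v = t := by
    intro v hv hvT
    obtain ⟨n, rfl, hn⟩ := SimpleGraph.Walk.mem_support_iff_exists_getVert.1 hv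
    have := hmin hvT (P.take n) fun v hv => hPs v (by
      rw [SimpleGraph.Walk.support_take] at hv
      exact List.mem_of_mem_take hv)
    rw [SimpleGraph.Walk.take_length] at this
    have : n = P.length := by omega
    rw [this, P.getVert_length]
  refine ⟨t, ht, P, hPath, ?_, fun v hv => ?_, hT, ?_, ?_⟩
  · rw [hP]
    exact (Nat.find_min' hQ hQ₀).trans hL₀
  · rcases hPs v hv with h | h | h
    · exact Or.inl h
    · exact Or.inr (Or.inl (hT v hv h))
    · exact Or.inr (Or.inr h)
  · intro j hj r hr
    obtain ⟨w, hw, hs⟩ := mem_reach_iff.1 hr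
    have := hmin ht (w.append (P.drop j)) fun v hv => by
      rw [SimpleGraph.Walk.mem_support_append_iff] at hv
      rcases hv with hv | hv
      · rcases hs v hv with h | h <;> tauto
      · rw [SimpleGraph.Walk.drop_support_eq_support_drop_min] at hv
        exact hPs v (List.mem_of_mem_drop hv)
    rw [SimpleGraph.Walk.length_append, SimpleGraph.Walk.drop_length] at this
    omega
  · intro j hj t' ht' r hr
    obtain ⟨w, hw, hs⟩ := mem_reach_iff.1 hr
    have := hmin ht' ((P.take j).append w.reverse) fun v hv => by
      rw [SimpleGraph.Walk.mem_support_append_iff, SimpleGraph.Walk.support_reverse,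
        List.mem_reverse] at hv
      rcases hv with hv | hv
      · rw [SimpleGraph.Walk.support_take] at hv
        exact hPs v (List.mem_of_mem_take hv)
      · rcases hs v hv with rfl | h <;> tauto
    rw [SimpleGraph.Walk.length_append, SimpleGraph.Walk.take_length,
      SimpleGraph.Walk.length_reverse] at this
    omega

theorem thin_union_path [Finite V] {G : SimpleGraph V} {U F : Set V} {x a b : V} {R q : ℕ}
    {P : G.Walk a b} (hUF : U ⊆ F) (hfar : ∀ v ∈ F, v ∈ reach G ∅ x R → v ∈ U)
    (hP : ∀ v ∈ P.support, v ∉ U → v ∉ F) {I : ℕ → Set ℕ}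
    (hI : ∀ r, (I r).Finite ∧ (I r).ncard ≤ r)
    (hpos : ∀ j ≤ P.length, ∀ r, P.getVert j ∈ reach G F x r → P.getVert j ∉ U → j ∈ I r)
    (h : Thin G U x R q) : Thin G (U ∪ {v | v ∈ P.support}) x R (q + 1) := by
  intro r hr
  have hsub : extNbr G (reach G (U ∪ {v | v ∈ P.support}) x r) ∩ (U ∪ {v | v ∈ P.support}) ⊆
      (extNbr G (reach G U x r) ∩ U) ∪ P.getVert '' I (r + 1) := by
    rintro v ⟨⟨hv, z, hz, hzv⟩, hvU⟩
    have hzU : z ∈ reach G U x r := reach_anti Set.subset_union_left hz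
    have hzF : z ∈ reach G F x r := by rwa [reach_congr hUF hfar hr.le]
    by_cases hvU' : v ∈ U
    · refine Or.inl ⟨⟨fun hvr => ?_, z, hzU, hzv⟩, hvU'⟩
      obtain ⟨w, hw, hs⟩ := mem_reach_iff.1 hvr
      rcases hs v w.end_mem_support with rfl | h
      · exact hv self_mem_reach
      · exact h hvU'
    · right
      have hvP : v ∈ P.support := hvU.resolve_left hvU'
      have hvF := hP v hvP hvU'
      obtain ⟨j, rfl, hj⟩ := SimpleGraph.Walk.mem_support_iff_exists_getVert.1 hvP
      refine ⟨j, hpos j hj (r + 1) ?_ hvU', rfl⟩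
      by_cases hvr : P.getVert j ∈ reach G F x r
      · exact reach_mono (Nat.le_succ r) hvr
      · exact Or.inr ⟨⟨hvr, z, hzF, hzv⟩, hvF⟩
  have h1 := Set.ncard_image_le (f := P.getVert) (hI (r + 1)).1
  have h2 := (hI (r + 1)).2
  refine (Set.ncard_le_ncard hsub).trans ((Set.ncard_union_le _ _).trans ?_)
  have := h r hr
  nlinarith

/-- Connecting a vertex to a set by a short path that avoids `U` and the surroundings of all
other protected vertices, with control on how the path crosses small balls. -/
theorem exists_connecting_path [Finite V] {G : SimpleGraph V} {ε d : ℝ} {M D : ℕ}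
    (hA : Ambient G ε d M D) {U Z T : Set V} {cur t₀ : V} {R₁ R₂ N₁ N₂ q : ℕ}
    (hZU : Z ⊆ U) (hTU : T ⊆ U) (hcurU : cur ∈ U) (ht₀ : t₀ ∈ T)
    (hU : U.ncard ≤ N₁) (hN : N₁ + N₁ * D ^ R₁ ≤ N₂) (hR : R₁ ≤ R₂)
    (h₁ : (2 * Real.log N₁) ^ 3 ≤ R₁) (h₂ : (2 * Real.log N₂) ^ 3 ≤ R₂)
    (hq : (q : ℝ) ≤ ε / 1800 * d) (hcur : Thin G U cur R₁ q) (ht : Thin G U t₀ R₁ q)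
    (hsep : ∀ z ∈ Z, z ≠ cur → z ∉ T → ∀ x, x = cur ∨ x ∈ T → x ∉ reach G ∅ z (R₁ + R₂)) :
    ∃ t ∈ T, ∃ P : G.Walk cur t, P.IsPath ∧ P.length ≤ 2 * M ∧
      (∀ v ∈ P.support, v ∈ U → v = cur ∨ v = t) ∧
      (∀ x q', x = cur ∨ x ∈ T → Thin G U x R₁ q' →
        Thin G (U ∪ {v | v ∈ P.support}) x R₁ (q' + 1)) ∧
      (∀ z ∈ Z, z ≠ cur → z ∉ T → ∀ q', Thin G U z R₁ q' →
        Thin G (U ∪ {v | v ∈ P.support}) z R₁ q') := by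
  set Z' : Set V := {z ∈ Z | z ≠ cur ∧ z ∉ T} with hZ'
  set F : Set V := U ∪ nbhd G Z' R₁ with hF
  have hUF : U ⊆ F := Set.subset_union_left
  have hFN : F.ncard ≤ N₂ := by
    refine (Set.ncard_union_le _ _).trans (le_trans ?_ hN)
    refine Nat.add_le_add hU ((ncard_nbhd_le hA.deg_lt _ _).trans (Nat.mul_le_mul_right _ ?_))
    exact (Set.ncard_le_ncard fun z hz => hZU hz.1).trans hU
  have hfar : ∀ x, x = cur ∨ x ∈ T → ∀ v ∈ F, v ∈ reach G ∅ x R₂ → v ∈ U := by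
    rintro x hx v (hv | hv) hvx
    · exact hv
    · obtain ⟨z, hz, hzv⟩ := mem_nbhd.1 hv
      exact absurd (reach_empty_trans hzv (reach_empty_symm hvx)) (hsep z hz.1 hz.2.1 hz.2.2 x hx)
  have hfar₁ : ∀ x, x = cur ∨ x ∈ T → ∀ v ∈ F, v ∈ reach G ∅ x R₁ → v ∈ U :=
    fun x hx v hv hvx => hfar x hx v hv (reach_mono hR hvx)
  obtain ⟨t, htT, P, hP, hlen, hPF, hPT, hg1, hg2⟩ := exists_shortest_path (M := M) ht₀
    (half_lt_ncard_reach_of_thin hA hUF hU hFN hq hcur (hfar cur (Or.inl rfl)) h₁ h₂)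
    (half_lt_ncard_reach_of_thin hA hUF hU hFN hq ht (hfar t₀ (Or.inr ht₀)) h₁ h₂)
  have hPU : ∀ v ∈ P.support, v ∈ U → v = cur ∨ v = t := by
    intro v hv hvU
    rcases hPF v hv with h | h | h
    · exact Or.inl h
    · exact Or.inr h
    · exact absurd (hUF hvU) h
  have hPF' : ∀ v ∈ P.support, v ∉ U → v ∉ F := by
    intro v hv hvU
    rcases hPF v hv with rfl | rfl | h
    · exact absurd hcurU hvU
    · exact absurd (hTU htT) hvU
    · exact h
  refine ⟨t, htT, P, hP, hlen, hPU, ?_, ?_⟩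
  · rintro x q' (rfl | hx) hthin
    · refine thin_union_path hUF (hfar₁ _ (Or.inl rfl)) hPF' (I := fun r => Set.Icc 1 r)
        (fun r => ⟨Set.finite_Icc _ _, by simp [Set.ncard_eq_toFinset_card']⟩) ?_ hthin
      intro j hj r hr hjU
      refine ⟨?_, hg1 j hj r hr⟩
      by_contra hj0
      obtain rfl : j = 0 := by omega
      exact hjU (by simpa using hcurU)
    · refine thin_union_path hUF (hfar₁ _ (Or.inr hx)) hPF'
        (I := fun r => Set.Ico (P.length - r) P.length)
        (fun r => ⟨Set.finite_Ico _ _, by simp [Set.ncard_eq_toFinset_card']; omega⟩) ?_ hthin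
      intro j hj r hr hjU
      have h1 := hg2 j hj x hx r hr
      refine ⟨by omega, lt_of_le_of_ne hj ?_⟩
      rintro rfl
      exact hjU (by simpa using hTU htT)
  · intro z hz hzc hzT q' hthin
    refine hthin.of_far Set.subset_union_left ?_
    rintro v (hv | hv) hvz
    · exact hv
    · by_contra hvU
      exact hPF' v hv hvU (Or.inr (mem_nbhd.2 ⟨z, ⟨hz, hzc, hzT⟩, hvz⟩))

/-- A cycle with a shortcut between two far apart vertices contains, together with the shortcut,
a shorter cycle. -/
theorem exists_shorter_cycle {G : SimpleGraph V} {x : V} (C : G.Walk x x) (hC : C.IsCycle) {i ρ : ℕ}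
    (hi : 2 * ρ < i) (hi' : i + 2 * ρ < C.length) (hy : C.getVert i ∈ reach G ∅ x ρ) :
    ∃ (w : V) (C' : G.Walk w w), C'.IsCycle ∧ 4 * C'.length ≤ 3 * C.length ∧
      ∀ v ∈ C'.support, v ∈ C.support ∨ v ∈ reach G ∅ x ρ := by
  classical
  have key : ∀ A : G.Walk x (C.getVert i), A.IsPath → 2 * ρ < A.length → 2 * A.length ≤ C.length →
      (∀ v ∈ A.support, v ∈ C.support) → ∃ (w : V) (C' : G.Walk w w), C'.IsCycle ∧
        4 * C'.length ≤ 3 * C.length ∧ ∀ v ∈ C'.support, v ∈ C.support ∨ v ∈ reach G ∅ x ρ := by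
    intro A hA hA1 hA2 hAs
    obtain ⟨Q₀, hQ₀⟩ := mem_reach_empty.1 hy
    have hQlen : Q₀.bypass.length ≤ ρ := Q₀.length_bypass_le_length.trans hQ₀
    have hne : A ≠ Q₀.bypass := by
      intro h
      rw [← h] at hQlen
      omega
    obtain ⟨w, -, -, c, hc, hsub⟩ := hA.exists_isCycle_sublist_of_ne Q₀.bypass_isPath hne
    refine ⟨w, c, hc, ?_, fun v hv => ?_⟩
    · have := hsub.length_le
      simp only [List.length_append, List.length_tail, List.length_reverse,
        SimpleGraph.Walk.length_support] at this
      omega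
    · have := hsub.subset hv
      rw [List.mem_append] at this
      rcases this with h | h
      · exact Or.inl (hAs v h)
      · right
        have h' : v ∈ Q₀.bypass.support := List.mem_reverse.1 (List.mem_of_mem_tail h)
        obtain ⟨n, rfl, hn⟩ := SimpleGraph.Walk.mem_support_iff_exists_getVert.1 h'
        exact mem_reach_empty.2
          ⟨Q₀.bypass.take n, by rw [SimpleGraph.Walk.take_length]; omega⟩
  by_cases hhalf : 2 * i ≤ C.length
  · refine key (C.take i) (hC.isPath_take (by omega)) ?_ ?_ fun v hv => ?_
    · rw [SimpleGraph.Walk.take_length]; omega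
    · rw [SimpleGraph.Walk.take_length]; omega
    · rw [SimpleGraph.Walk.support_take] at hv
      exact List.mem_of_mem_take hv
  · refine key (C.drop i).reverse (hC.isPath_drop (by omega)).reverse ?_ ?_ fun v hv => ?_
    · rw [SimpleGraph.Walk.length_reverse, SimpleGraph.Walk.drop_length]; omega
    · rw [SimpleGraph.Walk.length_reverse, SimpleGraph.Walk.drop_length]; omega
    · rw [SimpleGraph.Walk.support_reverse, List.mem_reverse,
        SimpleGraph.Walk.drop_support_eq_support_drop_min] at hv
      exact List.mem_of_mem_drop hv

/-- Repeatedly shortening a cycle yields one that meets every small ball around its vertices in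
few vertices. -/
theorem exists_thin_cycle [Finite V] {G : SimpleGraph V} {U : Set V} {a R m : ℕ} {w : V}
    (C : G.Walk w w) (hC : C.IsCycle) (hlen : C.length * 3 ^ m ≤ 2 * 4 ^ m)
    (havoid : ∀ v ∈ C.support, v ∉ nbhd G U (a + m * R)) :
    ∃ (w' : V) (C' : G.Walk w' w'), C'.IsCycle ∧ C'.length ≤ C.length ∧
      (∀ v ∈ C'.support, v ∉ nbhd G U a) ∧
      ∀ x ∈ C'.support, Thin G {v | v ∈ C'.support} x R 5 := by
  classical
  induction m generalizing w with
  | zero =>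
    have := hC.three_le_length
    omega
  | succ m ih =>
    by_cases hgood : ∀ x ∈ C.support, Thin G {v | v ∈ C.support} x R 5
    · refine ⟨w, C, hC, le_rfl, fun v hv hvU => havoid v hv ?_, hgood⟩
      exact nbhd_mono subset_rfl (Nat.le_add_right _ _) hvU
    unfold Thin at hgood
    push Not at hgood
    obtain ⟨x, hx, r, hr, hbad⟩ := hgood
    set C₁ := C.rotate x hx with hC₁
    have hC₁c : C₁.IsCycle := hC.rotate hx
    have hlen₁ : C₁.length = C.length := by simp [hC₁]
    have hsupp : ∀ v, v ∈ C₁.support ↔ v ∈ C.support := fun v => by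
      simp [hC₁]
    obtain ⟨i, hi, hi', hy⟩ : ∃ i, 2 * (r + 1) < i ∧ i + 2 * (r + 1) < C₁.length ∧
        C₁.getVert i ∈ reach G ∅ x (r + 1) := by
      by_contra hno
      push Not at hno
      have hsub : extNbr G (reach G {v | v ∈ C.support} x r) ∩ {v | v ∈ C.support} ⊆
          C₁.getVert '' (Set.Icc 1 (2 * (r + 1)) ∪
            Set.Icc (C₁.length - 2 * (r + 1)) C₁.length) := by
        rintro v ⟨hv, hvC⟩
        obtain ⟨i, rfl, hi⟩ := SimpleGraph.Walk.mem_support_iff_exists_getVert.1 ((hsupp v).2 hvC)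
        have hvr := extNbr_reach_subset hv
        have h0 : i ≠ 0 := by
          rintro rfl
          rw [SimpleGraph.Walk.getVert_zero] at hv
          exact hv.1 self_mem_reach
        refine ⟨i, ?_, rfl⟩
        by_cases h1 : i ≤ 2 * (r + 1)
        · exact Or.inl ⟨by omega, h1⟩
        · refine Or.inr ⟨?_, hi⟩
          by_contra h2
          exact hno i (by omega) (by omega) hvr
      have h1 := Set.ncard_le_ncard hsub
      have h2 := Set.ncard_image_le (f := C₁.getVert)
        ((Set.finite_Icc 1 (2 * (r + 1))).union
          (Set.finite_Icc (C₁.length - 2 * (r + 1)) C₁.length))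
      have h3 := Set.ncard_union_le (Set.Icc 1 (2 * (r + 1)))
        (Set.Icc (C₁.length - 2 * (r + 1)) C₁.length)
      simp only [Set.ncard_eq_toFinset_card', Set.toFinset_Icc, Nat.card_Icc] at h1 h2 h3 hbad
      omega
    obtain ⟨w', C', hC', hlen', hC's⟩ := exists_shorter_cycle C₁ hC₁c hi hi' hy
    obtain ⟨w'', C'', h1, h2, h3⟩ := ih C' hC' (by
        rw [pow_succ, pow_succ] at hlen
        have : 4 * C'.length * 3 ^ m ≤ 3 * C₁.length * 3 ^ m := Nat.mul_le_mul_right _ hlen'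
        rw [hlen₁] at this
        nlinarith) (fun v hv hvU => by
        rcases hC's v hv with h | h
        · refine havoid v ((hsupp v).1 h) (nbhd_mono subset_rfl ?_ hvU)
          rw [Nat.succ_mul]
          omega
        · refine havoid x hx (nbhd_mono subset_rfl ?_ (mem_nbhd_trans hvU (reach_empty_symm h)))
          rw [Nat.succ_mul]
          omega)
    exact ⟨w'', C'', h1, by omega, h3⟩

theorem exists_cycle_avoiding [Finite V] {G : SimpleGraph V} {ε d : ℝ} {M D : ℕ}
    (hA : Ambient G ε d M D) {U : Set V} {ρ R₁ R₃ N₁ N₃ : ℕ} (hU : U.ncard ≤ N₁) (hN₁ : 1 ≤ N₁)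
    (hN₃ : N₁ * D ^ ρ + 1 ≤ N₃) (h₁ : (2 * Real.log N₁) ^ 3 ≤ R₁)
    (h₃ : (2 * Real.log N₃) ^ 3 ≤ R₃) (hq : 1 ≤ ε / 1800 * d)
    (hcard : N₁ * D ^ (ρ + R₃ + 1) < Nat.card V) :
    ∃ (w : V) (C : G.Walk w w), C.IsCycle ∧ C.length ≤ 2 * M + 2 ∧
      ∀ v ∈ C.support, v ∉ nbhd G U ρ := by
  classical
  obtain ⟨w, hw⟩ : ∃ w, w ∉ nbhd G U (ρ + R₃ + 1) := by
    by_contra hall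
    push Not at hall
    have h1 : nbhd G U (ρ + R₃ + 1) = Set.univ := Set.eq_univ_of_forall hall
    have h2 := ncard_nbhd_le hA.deg_lt U (ρ + R₃ + 1)
    rw [h1, Set.ncard_univ] at h2
    have h3 : U.ncard * D ^ (ρ + R₃ + 1) ≤ N₁ * D ^ (ρ + R₃ + 1) := Nat.mul_le_mul_right _ hU
    omega
  have hd2 : (1 : ℝ) < ((G.neighborSet w).ncard : ℝ) := by
    have := hA.minDeg w
    have h1 := hA.le_mul
    have h2 := hA.eps_lt
    have h3 := hA.eps_pos
    nlinarith
  obtain ⟨a, b, ha, hb, hab⟩ := (Set.one_lt_ncard_iff (Set.toFinite _)).1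
    (by exact_mod_cast hd2 : 1 < (G.neighborSet w).ncard)
  rw [SimpleGraph.mem_neighborSet] at ha hb
  set F : Set V := {w} ∪ nbhd G U ρ with hF
  have hFN : F.ncard ≤ N₃ := by
    refine (Set.ncard_union_le _ _).trans (le_trans ?_ hN₃)
    rw [Set.ncard_singleton, add_comm]
    exact Nat.add_le_add_right
      ((ncard_nbhd_le hA.deg_lt _ _).trans (Nat.mul_le_mul_right _ hU)) _
  have hbig : ∀ a, G.Adj w a → (Nat.card V : ℝ) / 2 < (reach G F a M).ncard := by
    intro a ha
    refine half_lt_ncard_reach_of_thin hA (q := 1) (U := {w}) Set.subset_union_left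
      (by rw [Set.ncard_singleton]; exact hN₁) hFN (by simpa using hq) ?_ ?_ h₁ h₃
    · intro r _
      have := Set.ncard_le_ncard
        (Set.inter_subset_right : extNbr G (reach G {w} a r) ∩ {w} ⊆ {w})
      rw [Set.ncard_singleton] at this
      omega
    · rintro v (hv | hv) hva
      · exact hv
      · exfalso
        refine hw (mem_nbhd_trans (s := 1) (mem_nbhd_trans hv (reach_empty_symm hva)) ?_)
        exact mem_reach_empty.2 ⟨ha.symm.toWalk, by simp⟩
  have hnot : ∀ a, G.Adj w a → a ∉ nbhd G U ρ := by
    intro a ha haU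
    refine hw (nbhd_mono subset_rfl ?_ (mem_nbhd_trans haU
      (mem_reach_empty.2 ⟨ha.symm.toWalk, le_of_eq (by simp : _ = 1)⟩)))
    omega
  obtain ⟨t, rfl, P, hP, hlen, hPF, -⟩ := exists_shortest_path (T := {b}) (t₀ := b) rfl
    (hbig a ha) (hbig b hb)
  have hwP : w ∉ P.support := by
    intro h
    rcases hPF w h with h | h | h
    · exact ha.ne h
    · exact hb.ne h
    · exact h (Or.inl rfl)
  refine ⟨w, SimpleGraph.Walk.cons ha (P.concat hb.symm), ?_, ?_, ?_⟩
  · rw [SimpleGraph.Walk.cons_isCycle_iff]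
    refine ⟨hP.concat hwP hb.symm, fun he => ?_⟩
    rw [SimpleGraph.Walk.edges_concat, List.concat_eq_append, List.mem_append] at he
    rcases he with he | he
    · exact hwP (P.fst_mem_support_of_mem_edges he)
    · rw [List.mem_singleton, Sym2.eq_iff] at he
      rcases he with ⟨h, -⟩ | ⟨-, h⟩
      · exact hb.ne h
      · exact hab h
  · simp only [SimpleGraph.Walk.length_cons, SimpleGraph.Walk.length_concat]
    omega
  · intro v hv hvU
    rw [SimpleGraph.Walk.support_cons, List.mem_cons, SimpleGraph.Walk.support_concat,
      List.mem_append, List.mem_singleton] at hv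
    have hwU : w ∉ nbhd G U ρ := fun h => hw (nbhd_mono subset_rfl (by omega) h)
    rcases hv with rfl | hv | rfl
    · exact hwU hvU
    · rcases hPF v hv with rfl | rfl | h
      · exact hnot _ ha hvU
      · exact hnot _ hb hvU
      · exact h (Or.inr hvU)
    · exact hwU hvU

/-- For every `i ≤ a` there is a path from `x` to `y` inside `S` of length `Λ + 2 * i`. -/
def Flex (G : SimpleGraph V) (S : Set V) (x y : V) (Λ a : ℕ) : Prop :=
  ∀ i ≤ a, ∃ p : G.Walk x y, p.IsPath ∧ p.length = Λ + 2 * i ∧ ∀ v ∈ p.support, v ∈ S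

theorem Flex.append {G : SimpleGraph V} {S T : Set V} {x y z : V} {Λ Λ' a a' : ℕ}
    (h : Flex G S x y Λ a) (h' : Flex G T y z Λ' a') (hST : ∀ v ∈ S, v ∈ T → v = y) :
    Flex G (S ∪ T) x z (Λ + Λ') (a + a') := by
  intro i hi
  obtain ⟨p, hp, hpl, hps⟩ := h (min i a) (min_le_right _ _)
  obtain ⟨q, hq, hql, hqs⟩ := h' (i - min i a) (by omega)
  refine ⟨p.append q, ?_, ?_, fun v hv => ?_⟩
  · rw [SimpleGraph.Walk.isPath_def, SimpleGraph.Walk.support_append, List.nodup_append]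
    refine ⟨hp.support_nodup, hq.support_nodup.tail, ?_⟩
    rintro u hu v hv rfl
    obtain rfl := hST u (hps u hu) (hqs u (List.mem_of_mem_tail hv))
    have := hq.support_nodup
    rw [← q.cons_tail_support] at this
    exact (List.nodup_cons.1 this).1 hv
  · rw [SimpleGraph.Walk.length_append, hpl, hql]
    omega
  · rw [SimpleGraph.Walk.mem_support_append_iff] at hv
    exact hv.imp (hps v) (hqs v)

theorem Flex.of_path {G : SimpleGraph V} {x y : V} {p : G.Walk x y} (hp : p.IsPath) :
    Flex G {v | v ∈ p.support} x y p.length 0 := by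
  intro i hi
  exact ⟨p, hp, by omega, fun v hv => hv⟩

theorem Flex.symm {G : SimpleGraph V} {S : Set V} {x y : V} {Λ a : ℕ} (h : Flex G S x y Λ a) :
    Flex G S y x Λ a := by
  intro i hi
  obtain ⟨p, hp, hpl, hps⟩ := h i hi
  exact ⟨p.reverse, hp.reverse, by simpa using hpl, by simpa using hps⟩

theorem even_length_of_isBip {G : SimpleGraph V} {f : V → Bool}
    (hf : ∀ u v, G.Adj u v → f u ≠ f v) {x y : V} (p : G.Walk x y) :
    Even p.length ↔ f x = f y := by
  have := SimpleGraph.Coloring.even_length_iff_congr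
    (SimpleGraph.Coloring.mk f fun {u v} h => hf u v h : G.Coloring Bool) p
  rw [this]
  exact Bool.coe_iff_coe

theorem exists_flex_of_isCycle {G : SimpleGraph V} {f : V → Bool}
    (hf : ∀ u v, G.Adj u v → f u ≠ f v) {w : V} (C : G.Walk w w) (hC : C.IsCycle) :
    ∃ x y Λ, x ∈ C.support ∧ y ∈ C.support ∧ x ≠ y ∧ 1 ≤ Λ ∧ 2 * Λ ≤ C.length ∧
      Flex G {v | v ∈ C.support} x y Λ 1 := by
  obtain ⟨c, hc⟩ := (even_length_of_isBip hf C).2 rfl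
  have h3 := hC.three_le_length
  have hp1 : (C.take (c - 1)).IsPath := hC.isPath_take (by omega)
  have hl1 : (C.take (c - 1)).length = c - 1 := by
    rw [SimpleGraph.Walk.take_length]; omega
  have hp2 : (C.drop (c - 1)).reverse.IsPath := (hC.isPath_drop (by omega)).reverse
  have hl2 : (C.drop (c - 1)).reverse.length = c + 1 := by
    rw [SimpleGraph.Walk.length_reverse, SimpleGraph.Walk.drop_length]; omega
  refine ⟨w, C.getVert (c - 1), c - 1, C.start_mem_support, C.getVert_mem_support _, fun h => ?_,
    by omega, by omega, fun i hi => ?_⟩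
  · have h0 : (C.take (c - 1)).length = 0 := by
      have key : ∀ {a b : V} (p : G.Walk a b), p.IsPath → a = b → p.length = 0 := by
        rintro a b p hp rfl
        exact SimpleGraph.Walk.length_eq_zero_iff.2 (SimpleGraph.Walk.isPath_iff_nil.1 hp)
      exact key _ hp1 h
    omega
  · rcases Nat.le_one_iff_eq_zero_or_eq_one.1 hi with rfl | rfl
    · refine ⟨C.take (c - 1), hp1, by omega, fun v hv => ?_⟩
      rw [SimpleGraph.Walk.support_take] at hv
      exact List.mem_of_mem_take hv
    · refine ⟨(C.drop (c - 1)).reverse, hp2, by omega, fun v hv => ?_⟩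
      rw [SimpleGraph.Walk.support_reverse, List.mem_reverse,
        SimpleGraph.Walk.drop_support_eq_support_drop_min] at hv
      exact List.mem_of_mem_drop hv

theorem ncard_support_le [Finite V] {G : SimpleGraph V} {x y : V} (p : G.Walk x y) :
    {v | v ∈ p.support}.ncard ≤ p.length + 1 := by
  classical
  have : {v | v ∈ p.support} = (p.support.toFinset : Set V) := by
    ext v
    simp
  rw [this, Set.ncard_coe_finset, ← SimpleGraph.Walk.length_support]
  exact List.toFinset_card_le _

/-- A hierarchy of radii `R₁`, `R₂`, `R₃` and set sizes `N₁`, `N₂`, `N₃` such that a blocked set of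
size `Nᵢ` outside the ball of radius `Rᵢ` around a vertex does not stop the growth of balls. -/
structure Scales [Finite V] (G : SimpleGraph V) (ε d : ℝ)
    (M D R₁ R₂ R₃ N₁ N₂ N₃ J Q : ℕ) : Prop extends Ambient G ε d M D where
  one_le : 1 ≤ N₁
  radius_le : R₁ ≤ R₂
  size_two : N₁ + N₁ * D ^ R₁ ≤ N₂
  size_three : N₁ * D ^ (R₁ + R₂ + J * R₁) + 1 ≤ N₃
  log_one : (2 * Real.log N₁) ^ 3 ≤ R₁
  log_two : (2 * Real.log N₂) ^ 3 ≤ R₂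
  log_three : (2 * Real.log N₃) ^ 3 ≤ R₃
  lt_card : N₁ * D ^ (R₁ + R₂ + J * R₁ + R₃ + 1) < Nat.card V
  shrink : (2 * M + 2) * 3 ^ J ≤ 2 * 4 ^ J
  six_le : 6 ≤ Q
  thin_le : (Q : ℝ) ≤ ε / 1800 * d

section

variable [Finite V] {G : SimpleGraph V} {ε d : ℝ} {M D R₁ R₂ R₃ N₁ N₂ N₃ J Q : ℕ}

theorem Ambient.one_le (hA : Ambient G ε d M D) : 1 ≤ M := by
  have h1 := hA.log_lt
  have h2 := Real.log_natCast_nonneg (Nat.card V)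
  have h3 : (0 : ℝ) < M := lt_of_le_of_lt (by positivity) h1
  exact_mod_cast h3

theorem Scales.exists_cycle (hS : Scales G ε d M D R₁ R₂ R₃ N₁ N₂ N₃ J Q) {U : Set V}
    (hU : U.ncard ≤ N₁) :
    ∃ (w : V) (C : G.Walk w w), C.IsCycle ∧ C.length ≤ 2 * M + 2 ∧
      (∀ v ∈ C.support, v ∉ nbhd G U (R₁ + R₂)) ∧
      ∀ x ∈ C.support, Thin G {v | v ∈ C.support} x R₁ 5 := by
  have hq : 1 ≤ ε / 1800 * d := by
    have h1 := hS.thin_le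
    have h2 : (6 : ℝ) ≤ Q := by exact_mod_cast hS.six_le
    linarith
  obtain ⟨w, C, hC, hlen, hCU⟩ := exists_cycle_avoiding hS.toAmbient hU hS.one_le hS.size_three
    hS.log_one hS.log_three hq hS.lt_card
  obtain ⟨w', C', hC', hlen', h⟩ := exists_thin_cycle C hC
    ((Nat.mul_le_mul_right _ hlen).trans hS.shrink) hCU
  exact ⟨w', C', hC', hlen'.trans hlen, h⟩

/-- The state of the construction of a flexible path starting at the core vertex `u`: the flexible
path lives in `S` and ends at `cur`, and `W` contains everything used so far. -/
structure Stage (G : SimpleGraph V) (M R₁ R₂ Q : ℕ) (U Z : Set V) (f : V → ℕ) (u : V)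
    (a Λ : ℕ) (cur : V) (S W : Set V) : Prop where
  subset : U ⊆ W
  support_subset : S ⊆ W
  ncard_le : W.ncard ≤ U.ncard + a * (8 * M)
  flex : Flex G S u cur Λ a
  cur_mem : cur ∈ S
  inter : ∀ v ∈ S, v ∈ U → v = u
  thin_cur : Thin G W cur R₁ Q
  far : ∀ z ∈ Z, z ≠ cur → cur ∉ reach G ∅ z (R₁ + R₂)
  thin_of_ne : ∀ z ∈ Z, z ≠ u → Thin G W z R₁ (f z)
  thin_start : Thin G W u R₁ (f u + 1)
  thin_start_of_eq : cur = u → Thin G W u R₁ (f u)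
  le_length : a ≤ Λ
  length_le : Λ ≤ a * (4 * M)

theorem Stage.step (hS : Scales G ε d M D R₁ R₂ R₃ N₁ N₂ N₃ J Q) {g : V → Bool}
    (hg : ∀ u v, G.Adj u v → g u ≠ g v) {U Z : Set V} {f : V → ℕ} {u : V} (hZU : Z ⊆ U)
    (hu : u ∈ Z) {a Λ : ℕ} {cur : V} {S W : Set V}
    (h : Stage G M R₁ R₂ Q U Z f u a Λ cur S W) (hW : W.ncard + 8 * M ≤ N₁) :
    ∃ Λ' cur' S' W', Stage G M R₁ R₂ Q U Z f u (a + 1) Λ' cur' S' W' ∧ Λ' ≤ Λ + 4 * M := by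
  have hM := hS.toAmbient.one_le
  obtain ⟨w, C, hC, hlen, hCW, hCthin⟩ := hS.exists_cycle (U := W) (by omega)
  have hCcard := ncard_support_le C
  obtain ⟨x, y, lam, hx, hy, hxy, hlam, hlam', hflex⟩ := exists_flex_of_isCycle hg C hC
  set C' : Set V := {v | v ∈ C.support} with hC'
  have hdisj : ∀ v ∈ C', v ∉ W := fun v hv hvW => hCW v hv (subset_nbhd hvW)
  have hT : ({x, y} : Set V) ⊆ C' := by
    rintro v (rfl | rfl)
    exacts [hx, hy]
  have hcurW : cur ∈ W := h.support_subset h.cur_mem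
  have hcurC : cur ∉ C' := fun hc => hdisj _ hc hcurW
  have hZW : Z ⊆ W := hZU.trans h.subset
  have holdThin : ∀ v ∈ W, ∀ q, Thin G W v R₁ q → Thin G (W ∪ C') v R₁ q := by
    intro v hv q hq
    refine hq.of_far Set.subset_union_left ?_
    rintro z (hz | hz) hvz
    · exact hz
    · exact absurd (mem_nbhd.2 ⟨v, hv, reach_mono (Nat.le_add_right _ _) hvz⟩) (hCW z hz)
  have hnewThin : ∀ v ∈ C', Thin G (W ∪ C') v R₁ 5 := by
    intro v hv
    refine (hCthin v hv).of_far Set.subset_union_right ?_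
    rintro z (hz | hz) hvz
    · exact absurd (mem_nbhd.2 ⟨z, hz, reach_mono (Nat.le_add_right _ _) (reach_empty_symm hvz)⟩)
        (hCW v hv)
    · exact hz
  have hcardWC : (W ∪ C').ncard ≤ N₁ := by
    have := Set.ncard_union_le W C'
    omega
  have hQ5 : 5 ≤ Q := by have := hS.six_le; omega
  obtain ⟨t, ht, P, hP, hPlen, hPU, hthin, hthin'⟩ := exists_connecting_path hS.toAmbient
    (U := W ∪ C') (Z := Z) (T := {x, y}) (cur := cur) (t₀ := x) (q := Q)
    (hZW.trans Set.subset_union_left) (hT.trans Set.subset_union_right) (Or.inl hcurW)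
    (Or.inl rfl) hcardWC hS.size_two hS.radius_le hS.log_one hS.log_two hS.thin_le
    (holdThin _ hcurW _ h.thin_cur) ((hnewThin x hx).mono hQ5) (by
      rintro z hz hzc - v (rfl | hv)
      · exact h.far z hz hzc
      · exact fun hvz => hCW v (hT hv) (mem_nbhd.2 ⟨z, hZW hz, hvz⟩))
  obtain ⟨y', hy', hyt, hflex'⟩ : ∃ y' ∈ ({x, y} : Set V), y' ≠ t ∧ Flex G C' t y' lam 1 := by
    rcases ht with rfl | rfl
    · exact ⟨y, Or.inr rfl, hxy.symm, hflex⟩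
    · exact ⟨x, Or.inl rfl, hxy, hflex.symm⟩
  have htC : t ∈ C' := hT ht
  have hyC : y' ∈ C' := hT hy'
  have hcardP := ncard_support_le P
  have hSP : ∀ v ∈ S, v ∈ {v | v ∈ P.support} → v = cur := by
    intro v hv hvP
    rcases hPU v hvP (Or.inl (h.support_subset hv)) with h' | rfl
    · exact h'
    · exact absurd (h.support_subset hv) (hdisj _ htC)
  have hSPC : ∀ v ∈ S ∪ {v | v ∈ P.support}, v ∈ C' → v = t := by
    rintro v (hv | hv) hvC
    · exact absurd (h.support_subset hv) (hdisj _ hvC)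
    · rcases hPU v hv (Or.inr hvC) with rfl | h'
      · exact absurd hvC hcurC
      · exact h'
  have hyu : y' ≠ u := by
    rintro rfl
    exact hdisj _ hyC (hZW hu)
  have hZC : ∀ z ∈ Z, z ∉ ({x, y} : Set V) := fun z hz hzT => hdisj _ (hT hzT) (hZW hz)
  refine ⟨Λ + P.length + lam, y', S ∪ {v | v ∈ P.support} ∪ C',
    W ∪ C' ∪ {v | v ∈ P.support}, ?_, by omega⟩
  constructor
  · exact h.subset.trans (Set.subset_union_left.trans Set.subset_union_left)
  · rintro v ((hv | hv) | hv)
    · exact Or.inl (Or.inl (h.support_subset hv))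
    · exact Or.inr hv
    · exact Or.inl (Or.inr hv)
  · have h1 := Set.ncard_union_le (W ∪ C') {v | v ∈ P.support}
    have h2 := Set.ncard_union_le W C'
    have h3 := h.ncard_le
    rw [Nat.add_mul]
    omega
  · exact (h.flex.append (Flex.of_path hP) hSP).append hflex' hSPC
  · exact Or.inr hyC
  · rintro v ((hv | hv) | hv) hvU
    · exact h.inter v hv hvU
    · rcases hPU v hv (Or.inl (h.subset hvU)) with rfl | rfl
      · exact h.inter _ h.cur_mem hvU
      · exact absurd (h.subset hvU) (hdisj _ htC)
    · exact absurd (h.subset hvU) (hdisj _ hv)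
  · exact (hthin y' 5 (Or.inr hy') (hnewThin y' hyC)).mono hS.six_le
  · exact fun z hz _ hvz => hCW y' hyC (mem_nbhd.2 ⟨z, hZW hz, hvz⟩)
  · intro z hz hzu
    have hzc : z ≠ cur := by
      rintro rfl
      exact hzu (h.inter _ h.cur_mem (hZU hz))
    exact hthin' z hz hzc (hZC z hz) _ (holdThin z (hZW hz) _ (h.thin_of_ne z hz hzu))
  · by_cases hcu : cur = u
    · exact hthin u _ (Or.inl hcu.symm) (holdThin u (hZW hu) _ (h.thin_start_of_eq hcu))
    · exact hthin' u hu (Ne.symm hcu) (hZC u hu) _ (holdThin u (hZW hu) _ h.thin_start)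
  · exact fun h' => absurd h' hyu
  · have := h.le_length
    omega
  · have := h.length_le
    rw [Nat.add_mul]
    omega

end

section

variable [Finite V] {G : SimpleGraph V} {ε d : ℝ} {M D R₁ R₂ R₃ N₁ N₂ N₃ J Q : ℕ}

theorem exists_terminal_stage (hS : Scales G ε d M D R₁ R₂ R₃ N₁ N₂ N₃ J Q) {g : V → Bool}
    (hg : ∀ u v, G.Adj u v → g u ≠ g v) {U Z : Set V} {f : V → ℕ} {u : V} (hZU : Z ⊆ U)
    (hu : u ∈ Z) (hfar : ∀ z ∈ Z, z ≠ u → u ∉ reach G ∅ z (R₁ + R₂))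
    (hf : ∀ z ∈ Z, Thin G U z R₁ (f z)) (hfQ : ∀ z ∈ Z, f z ≤ Q) {ℓ : ℕ} (hℓ : 3 * M ≤ ℓ)
    (hU : U.ncard + (ℓ + 1) * (8 * M) ≤ N₁) :
    ∃ a Λ cur S W, Stage G M R₁ R₂ Q U Z f u a Λ cur S W ∧ Λ + 3 * M ≤ ℓ ∧ ℓ < Λ + 7 * M := by
  by_contra hno
  push Not at hno
  have key : ∀ a, ∃ Λ cur S W, Stage G M R₁ R₂ Q U Z f u a Λ cur S W ∧ Λ + 3 * M ≤ ℓ := by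
    intro a
    induction a with
    | zero =>
      refine ⟨0, u, {u}, U, ?_, by omega⟩
      constructor
      · exact subset_rfl
      · exact Set.singleton_subset_iff.2 (hZU hu)
      · omega
      · intro i hi
        obtain rfl : i = 0 := by omega
        exact ⟨SimpleGraph.Walk.nil, by simp, by simp, by simp⟩
      · rfl
      · exact fun v hv _ => hv
      · exact (hf u hu).mono (hfQ u hu)
      · exact hfar
      · exact fun z hz _ => hf z hz
      · exact (hf u hu).mono (Nat.le_succ _)
      · exact fun _ => hf u hu
      · omega
      · omega
    | succ a ih =>
      obtain ⟨Λ, cur, S, W, h, hΛ⟩ := ih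
      have hΛ' := hno a Λ cur S W h hΛ
      have hW : W.ncard + 8 * M ≤ N₁ := by
        have h1 := h.ncard_le
        have h2 := h.le_length
        have h3 : a * (8 * M) ≤ ℓ * (8 * M) := Nat.mul_le_mul_right _ (by omega)
        rw [Nat.add_mul] at hU
        omega
      obtain ⟨Λ', cur', S', W', h', hle⟩ := h.step hS hg hZU hu hW
      exact ⟨Λ', cur', S', W', h', by omega⟩
  obtain ⟨Λ, cur, S, W, h, hΛ⟩ := key (ℓ + 1)
  have := h.le_length
  omega

/-- Joining two core vertices by a path of prescribed length. -/
theorem exists_path_between (hS : Scales G ε d M D R₁ R₂ R₃ N₁ N₂ N₃ J Q) {g : V → Bool}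
    (hg : ∀ u v, G.Adj u v → g u ≠ g v) {U Z : Set V} {f : V → ℕ} {u v : V} (hZU : Z ⊆ U)
    (hu : u ∈ Z) (hv : v ∈ Z) (huv : u ≠ v) (hguv : g u = g v)
    (hfar : ∀ z ∈ Z, ∀ z' ∈ Z, z ≠ z' → z' ∉ reach G ∅ z (R₁ + R₂))
    (hf : ∀ z ∈ Z, Thin G U z R₁ (f z)) (hfQ : ∀ z ∈ Z, f z ≤ Q)
    (hU : U.ncard + (30 * M ^ 2 + 2) * (8 * M) ≤ N₁) :
    ∃ (p : G.Walk u v) (W : Set V), p.IsPath ∧ p.length = 30 * M ^ 2 ∧ U ⊆ W ∧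
      (∀ x ∈ p.support, x ∈ W) ∧ (∀ x ∈ p.support, x ∈ U → x = u ∨ x = v) ∧
      W.ncard ≤ U.ncard + (30 * M ^ 2 + 2) * (8 * M) ∧
      (∀ z ∈ Z, Thin G W z R₁ (f z + 1)) ∧
      (∀ z ∈ Z, z ≠ u → z ≠ v → Thin G W z R₁ (f z)) := by
  have hM := hS.toAmbient.one_le
  have hMM : M ≤ M ^ 2 := by nlinarith
  obtain ⟨a, Λ, cur, S, W, h, hΛ, hΛ'⟩ := exists_terminal_stage hS hg hZU hu
    (fun z hz hzu => hfar z hz u hu hzu) hf hfQ (ℓ := 30 * M ^ 2) (by omega)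
    (le_trans (Nat.add_le_add_left (Nat.mul_le_mul_right _ (by omega)) _) hU)
  have hcurU : cur ∈ U → cur = u := h.inter _ h.cur_mem
  have hvcur : v ≠ cur := by
    rintro rfl
    exact huv (hcurU (hZU hv)).symm
  have hWcard : W.ncard ≤ U.ncard + 30 * M ^ 2 * (8 * M) := by
    have h1 := h.ncard_le
    have h2 := h.le_length
    have h3 : a * (8 * M) ≤ 30 * M ^ 2 * (8 * M) := Nat.mul_le_mul_right _ (by omega)
    omega
  have hZW := hZU.trans h.subset
  obtain ⟨t, rfl, P, hP, hPlen, hPU, hthin, hthin'⟩ := exists_connecting_path hS.toAmbient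
    (U := W) (Z := Z) (T := {v}) (cur := cur) (t₀ := v) (q := Q) hZW
    (Set.singleton_subset_iff.2 (hZW hv)) (h.support_subset h.cur_mem) rfl
    (by rw [Nat.add_mul] at hU; omega) hS.size_two hS.radius_le hS.log_one hS.log_two hS.thin_le
    h.thin_cur ((h.thin_of_ne v hv huv.symm).mono (hfQ v hv)) (by
      rintro z hz hzc hzT x (rfl | rfl)
      · exact h.far z hz hzc
      · exact hfar z hz x hv hzT)
  have hcardP := ncard_support_le P
  have hflex := h.flex.append (Flex.of_path hP) (by
    intro x hx hxP
    rcases hPU x hxP (h.support_subset hx) with h' | rfl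
    · exact h'
    · exact absurd (h.inter _ hx (hZU hv)) huv.symm)
  have heven : Even (Λ + P.length) := by
    obtain ⟨p, -, hp, -⟩ := hflex 0 (Nat.zero_le _)
    rw [mul_zero, add_zero] at hp
    rw [← hp]
    exact (even_length_of_isBip hg p).2 hguv
  have ha : 4 * M ≤ a := by
    have h1 := h.length_le
    by_contra hlt
    push Not at hlt
    have h2 : a * (4 * M) ≤ (4 * M - 1) * (4 * M) := Nat.mul_le_mul_right _ (by omega)
    have h3 : (4 * M - 1) * (4 * M) ≤ 16 * M ^ 2 := by
      calc (4 * M - 1) * (4 * M) ≤ 4 * M * (4 * M) := Nat.mul_le_mul_right _ (Nat.sub_le _ _)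
        _ = 16 * M ^ 2 := by ring
    omega
  obtain ⟨e, he⟩ := heven
  have he2 : 30 * M ^ 2 = 2 * (15 * M ^ 2) := by ring
  obtain ⟨p, hp, hplen, hpS⟩ := hflex (15 * M ^ 2 - e) (by omega)
  refine ⟨p, W ∪ {x | x ∈ P.support}, hp, by omega, h.subset.trans Set.subset_union_left,
    ?_, ?_, ?_, ?_, ?_⟩
  · intro x hx
    exact (hpS x hx).imp (fun hx => h.support_subset hx) id
  · intro x hx hxU
    rcases hpS x hx with hxS | hxP
    · exact Or.inl (h.inter x hxS hxU)
    · rcases hPU x hxP (h.subset hxU) with rfl | h'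
      · exact Or.inl (hcurU hxU)
      · exact Or.inr h'
  · have := Set.ncard_union_le W {x | x ∈ P.support}
    rw [Nat.add_mul]
    omega
  · intro z hz
    by_cases hzc : z = cur
    · have hcu : cur = u := hcurU (hzc ▸ hZU hz)
      subst hcu
      subst hzc
      exact hthin z _ (Or.inl rfl) (h.thin_start_of_eq rfl)
    · by_cases hzv : z = t
      · subst hzv
        exact hthin z _ (Or.inr rfl) (h.thin_of_ne z hz huv.symm)
      · refine hthin' z hz hzc hzv _ ?_
        by_cases hzu : z = u
        · subst hzu
          exact h.thin_start
        · exact (h.thin_of_ne z hz hzu).mono (Nat.le_succ _)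
  · intro z hz hzu hzv
    refine hthin' z hz ?_ hzv _ (h.thin_of_ne z hz hzu)
    rintro rfl
    exact hzu (hcurU (hZU hz))

theorem exists_paths_of_pairs (hS : Scales G ε d M D R₁ R₂ R₃ N₁ N₂ N₃ J Q) {g : V → Bool}
    (hg : ∀ u v, G.Adj u v → g u ≠ g v) {k : ℕ} {c : Fin k → V} (hc : Function.Injective c)
    (hgc : ∀ i j, g (c i) = g (c j))
    (hfar : ∀ i j, i ≠ j → c j ∉ reach G ∅ (c i) (R₁ + R₂)) (hkQ : 2 * k ≤ Q)
    (hN : k + k ^ 2 * ((30 * M ^ 2 + 2) * (8 * M)) ≤ N₁) (E : Finset (Fin k × Fin k))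
    (hE : ∀ e ∈ E, e.1 < e.2) :
    ∃ (p : ∀ e : Fin k × Fin k, e ∈ E → G.Walk (c e.1) (c e.2)) (U : Set V),
      Set.range c ⊆ U ∧ U.ncard ≤ k + E.card * ((30 * M ^ 2 + 2) * (8 * M)) ∧
      (∀ e he, (p e he).IsPath ∧ (p e he).length = 30 * M ^ 2) ∧
      (∀ e he, ∀ x ∈ (p e he).support, x ∈ U ∧ (x ∈ Set.range c → x = c e.1 ∨ x = c e.2)) ∧
      (∀ e he e' he', e ≠ e' → ∀ x ∈ (p e he).support, x ∈ (p e' he').support →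
        x ∈ Set.range c) ∧
      ∀ i, Thin G U (c i) R₁ (E.filter fun e => e.1 = i ∨ e.2 = i).card := by
  classical
  induction E using Finset.induction_on with
  | empty =>
    refine ⟨fun e he => absurd he (Finset.notMem_empty _), Set.range c, subset_rfl, ?_, ?_, ?_, ?_,
      ?_⟩
    · rw [← Set.image_univ]
      refine (Set.ncard_image_le).trans ?_
      simp [Set.ncard_univ]
    · exact fun e he => absurd he (Finset.notMem_empty _)
    · exact fun e he => absurd he (Finset.notMem_empty _)
    · exact fun e he => absurd he (Finset.notMem_empty _)
    · intro i r hr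
      have : extNbr G (reach G (Set.range c) (c i) r) ∩ Set.range c = ∅ := by
        rw [Set.eq_empty_iff_forall_notMem]
        rintro v ⟨hv, j, rfl⟩
        have hv' := reach_mono (s := R₁ + R₂) (by omega) (extNbr_reach_subset hv)
        have hij : i = j := by
          by_contra hij
          exact hfar i j hij hv'
        subst hij
        exact hv.1 self_mem_reach
      rw [this]
      simp
  | insert e₀ E he₀ ih =>
    obtain ⟨p, U, hcU, hUcard, hp, hpU, hpp, hthin⟩ := ih fun e he =>
      hE e (Finset.mem_insert_of_mem he)
    have he₀lt := hE e₀ (Finset.mem_insert_self _ _)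
    have hEk : E.card + 1 ≤ k ^ 2 := by
      rw [← Finset.card_insert_of_notMem he₀]
      refine (Finset.card_le_univ _).trans ?_
      simp [sq]
    have hB : (E.card + 1) * ((30 * M ^ 2 + 2) * (8 * M)) ≤
        k ^ 2 * ((30 * M ^ 2 + 2) * (8 * M)) := Nat.mul_le_mul_right _ hEk
    rw [Nat.add_mul, one_mul] at hB
    let f : V → ℕ := fun v => (E.filter fun e => c e.1 = v ∨ c e.2 = v).card
    have hf : ∀ i, f (c i) = (E.filter fun e => e.1 = i ∨ e.2 = i).card := fun i => by
      simp only [f, hc.eq_iff]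
    have hfk : ∀ i, f (c i) ≤ Q := by
      intro i
      rw [hf]
      refine le_trans ?_ hkQ
      have hsub : (E.filter fun e => e.1 = i ∨ e.2 = i) ⊆
          (Finset.univ.image fun j => (i, j)) ∪ (Finset.univ.image fun j => (j, i)) := by
        rintro ⟨a, b⟩ hab
        simp only [Finset.mem_filter] at hab
        rcases hab.2 with rfl | rfl
        · exact Finset.mem_union_left _ (Finset.mem_image.2 ⟨b, Finset.mem_univ _, rfl⟩)
        · exact Finset.mem_union_right _ (Finset.mem_image.2 ⟨a, Finset.mem_univ _, rfl⟩)
      refine (Finset.card_le_card hsub).trans ((Finset.card_union_le _ _).trans ?_)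
      have h1 := Finset.card_image_le (s := (Finset.univ : Finset (Fin k))) (f := fun j => (i, j))
      have h2 := Finset.card_image_le (s := (Finset.univ : Finset (Fin k))) (f := fun j => (j, i))
      rw [Finset.card_univ, Fintype.card_fin] at h1 h2
      omega
    obtain ⟨q, W, hq, hqlen, hUW, hqW, hqU, hWcard, hthin₁, hthin₂⟩ := exists_path_between hS hg
      (U := U) (Z := Set.range c) (f := f) (u := c e₀.1) (v := c e₀.2) hcU ⟨_, rfl⟩ ⟨_, rfl⟩
      (fun h => he₀lt.ne (hc h)) (hgc _ _) (by
        rintro _ ⟨i, rfl⟩ _ ⟨j, rfl⟩ hij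
        exact hfar i j fun h => hij (h ▸ rfl)) (by
        rintro _ ⟨i, rfl⟩
        rw [hf]
        exact hthin i) (by
        rintro _ ⟨i, rfl⟩
        exact hfk i) (by omega)
    refine ⟨fun e he => if h : e = e₀ then h ▸ q else p e (Finset.mem_of_mem_insert_of_ne he h), W,
      hcU.trans hUW, ?_, ?_, ?_, ?_, ?_⟩
    · rw [Finset.card_insert_of_notMem he₀, Nat.add_mul, one_mul]
      omega
    · intro e he
      by_cases h : e = e₀
      · subst h
        simpa using ⟨hq, hqlen⟩
      · simpa [h] using hp e _
    · intro e he x hx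
      by_cases h : e = e₀
      · subst h
        simp only [dite_true] at hx
        exact ⟨hqW x hx, fun hxc => hqU x hx (hcU hxc)⟩
      · simp only [h, dite_false] at hx
        have := hpU e _ x hx
        exact ⟨hUW this.1, this.2⟩
    · intro e he e' he' hne x hx hx'
      have hcore : ∀ e he, x ∈ (p e he).support → x ∈ q.support → x ∈ Set.range c := by
        intro e he hx hx'
        rcases hqU x hx' (hpU e he x hx).1 with rfl | rfl <;> exact ⟨_, rfl⟩
      by_cases h : e = e₀
      · subst h
        simp only [dite_true] at hx
        simp only [hne.symm, dite_false] at hx'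
        exact hcore _ _ hx' hx
      · simp only [h, dite_false] at hx
        by_cases h' : e' = e₀
        · subst h'
          simp only [dite_true] at hx'
          exact hcore _ _ hx hx'
        · simp only [h', dite_false] at hx'
          exact hpp _ _ _ _ hne x hx hx'
    · intro i
      by_cases hi : e₀.1 = i ∨ e₀.2 = i
      · rw [Finset.filter_insert, if_pos hi, Finset.card_insert_of_notMem
          (fun h => he₀ (Finset.mem_filter.1 h).1), ← hf]
        exact hthin₁ _ ⟨i, rfl⟩
      · rw [Finset.filter_insert, if_neg hi, ← hf]
        push Not at hi
        exact hthin₂ _ ⟨i, rfl⟩ (fun h => hi.1 (hc h).symm) (fun h => hi.2 (hc h).symm)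

theorem containsBalSub_of_cores (hS : Scales G ε d M D R₁ R₂ R₃ N₁ N₂ N₃ J Q) {g : V → Bool}
    (hg : ∀ u v, G.Adj u v → g u ≠ g v) {k : ℕ} {c : Fin k → V} (hc : Function.Injective c)
    (hgc : ∀ i j, g (c i) = g (c j))
    (hfar : ∀ i j, i ≠ j → c j ∉ reach G ∅ (c i) (R₁ + R₂)) (hkQ : 2 * k ≤ Q)
    (hN : k + k ^ 2 * ((30 * M ^ 2 + 2) * (8 * M)) ≤ N₁) :
    ContainsBalSub G k (30 * M ^ 2) := by
  classical
  obtain ⟨p, U, -, -, hp, hpU, hpp, -⟩ := exists_paths_of_pairs hS hg hc hgc hfar hkQ hN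
    (Finset.univ.filter fun e => e.1 < e.2) (by simp)
  have hmem : ∀ i j : Fin k, i < j →
      (i, j) ∈ Finset.univ.filter fun e : Fin k × Fin k => e.1 < e.2 := by simp
  refine ⟨c, hc, fun i j h => p (i, j) (hmem i j h), fun i j h => hp _ _, fun i j h q hq => ?_,
    fun i j h i' j' h' hne x hx hx' => ?_⟩
  · exact ((hpU _ _ _ hq).2 ⟨q, rfl⟩).imp (fun h => hc h) (fun h => hc h)
  · have hxc := hpp _ _ _ _ hne x hx hx'
    exact ⟨(hpU _ _ _ hx).2 hxc, (hpU _ _ _ hx').2 hxc⟩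

end

section

variable [Finite V] {G : SimpleGraph V} {ε d : ℝ} {M D R₁ R₂ R₃ N₁ N₂ N₃ J Q : ℕ}

theorem Ambient.two_le_deg [Nonempty V] (hA : Ambient G ε d M D) : 2 ≤ D := by
  obtain ⟨v⟩ := ‹Nonempty V›
  have h := hA.deg_lt v
  have hd : (0 : ℝ) < ((G.neighborSet v).ncard : ℝ) := by
    have := hA.minDeg v
    have h1 := hA.le_mul
    have h2 := hA.eps_lt
    have h3 := hA.eps_pos
    nlinarith
  have : 0 < (G.neighborSet v).ncard := by exact_mod_cast hd
  omega

theorem exists_far_of_lt_ncard {X : Set V} (hD : ∀ v, (G.neighborSet v).ncard + 1 ≤ D) {R k : ℕ}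
    (hX : k * D ^ R < X.ncard) :
    ∃ c : Fin k → V, Function.Injective c ∧ (∀ i, c i ∈ X) ∧
      ∀ i j, i ≠ j → c j ∉ reach G ∅ (c i) R := by
  induction k with
  | zero => exact ⟨Fin.elim0, fun i => i.elim0, fun i => i.elim0, fun i => i.elim0⟩
  | succ k ih =>
    rw [Nat.add_mul, one_mul] at hX
    obtain ⟨c, hc, hcX, hfar⟩ := ih (by omega)
    have hcard : (nbhd G (Set.range c) R).ncard ≤ k * D ^ R := by
      refine (ncard_nbhd_le hD _ _).trans (Nat.mul_le_mul_right _ ?_)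
      rw [← Set.image_univ]
      refine (Set.ncard_image_le).trans ?_
      simp [Set.ncard_univ]
    obtain ⟨v, hvX, hv⟩ := Set.exists_mem_notMem_of_ncard_lt_ncard
      (s := nbhd G (Set.range c) R) (t := X) (by omega)
    have hv' : ∀ i, v ∉ reach G ∅ (c i) R := fun i h => hv (mem_nbhd.2 ⟨_, ⟨i, rfl⟩, h⟩)
    refine ⟨Fin.cons v c, ?_, ?_, ?_⟩
    · rw [Fin.cons_injective_iff]
      refine ⟨?_, hc⟩
      rintro ⟨i, rfl⟩
      exact hv' i self_mem_reach
    · intro i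
      refine Fin.cases ?_ (fun i => ?_) i
      · exact hvX
      · exact hcX i
    · intro i j
      refine Fin.cases ?_ (fun i => ?_) i <;> refine Fin.cases ?_ (fun j => ?_) j
      · simp
      · intro _ h
        exact hv' j (reach_empty_symm h)
      · intro _
        exact hv' i
      · intro hij
        exact hfar i j fun h => hij (h ▸ rfl)

theorem Scales.containsBalSub (hS : Scales G ε d M D R₁ R₂ R₃ N₁ N₂ N₃ J Q) (hG : IsBip G) {k : ℕ}
    (hkQ : 2 * k ≤ Q) (hN : k + k ^ 2 * ((30 * M ^ 2 + 2) * (8 * M)) ≤ N₁) :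
    ContainsBalSub G k (30 * M ^ 2) := by
  obtain ⟨g, hg⟩ := hG
  have hV : Nonempty V := (Nat.card_pos_iff.1 (Nat.zero_lt_of_lt hS.lt_card)).1
  have hD := hS.toAmbient.two_le_deg
  have hk : 2 * (k * D ^ (R₁ + R₂)) < Nat.card V := by
    refine lt_of_le_of_lt ?_ hS.lt_card
    calc 2 * (k * D ^ (R₁ + R₂)) ≤ D * (N₁ * D ^ (R₁ + R₂)) := by gcongr; omega
      _ = N₁ * D ^ (R₁ + R₂ + 1) := by ring
      _ ≤ _ := Nat.mul_le_mul_left _ (Nat.pow_le_pow_right (by omega) (by omega))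
  obtain ⟨b, hb⟩ : ∃ b, k * D ^ (R₁ + R₂) < {v | g v = b}.ncard := by
    by_contra hno
    push Not at hno
    have h1 := Set.ncard_union_le {v | g v = true} {v | g v = false}
    have h2 : {v | g v = true} ∪ {v | g v = false} = Set.univ := by
      ext v
      simp
    rw [h2, Set.ncard_univ] at h1
    have h3 := hno true
    have h4 := hno false
    omega
  obtain ⟨c, hc, hcb, hfar⟩ := exists_far_of_lt_ncard hS.deg_lt hb
  exact containsBalSub_of_cores hS hg hc (fun i j => (hcb i).trans (hcb j).symm) hfar hkQ hN

end

/-- A hierarchy of radii and set sizes, all given by powers of `3` and of a large number `m`. -/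
theorem exists_hierarchy (S : ℕ) : ∃ m₀ : ℕ, ∀ m ≥ m₀,
    (2 * 3 ^ (3 * m) + 4) * 3 ^ (16 * m) ≤ 2 * 4 ^ (16 * m) ∧
    4 * (3 ^ m) ^ (2 * S + 10) + 2 ≤ 3 ^ ((2 * S + 12) * m) ∧
    (∀ k ≤ 2 * (3 ^ m) ^ S, k + k ^ 2 * ((30 * (3 ^ (3 * m) + 1) ^ 2 + 2) *
      (8 * (3 ^ (3 * m) + 1))) ≤ 3 ^ ((2 * S + 20) * m)) ∧
    m ^ 4 ≤ m ^ 19 ∧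
    3 ^ ((2 * S + 20) * m) + 3 ^ ((2 * S + 20) * m) * (3 ^ ((2 * S + 12) * m)) ^ m ^ 4 ≤
      3 ^ m ^ 6 ∧
    3 ^ ((2 * S + 20) * m) *
      (3 ^ ((2 * S + 12) * m)) ^ (m ^ 4 + m ^ 19 + 16 * m * m ^ 4) + 1 ≤ 3 ^ m ^ 22 ∧
    (4 * ((2 * S + 20) * m)) ^ 3 ≤ m ^ 4 ∧ (4 * m ^ 6) ^ 3 ≤ m ^ 19 ∧
    (4 * m ^ 22) ^ 3 ≤ m ^ 67 ∧
    3 ^ ((2 * S + 20) * m) *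
      (3 ^ ((2 * S + 12) * m)) ^ (m ^ 4 + m ^ 19 + 16 * m * m ^ 4 + m ^ 67 + 1) ≤ 3 ^ m ^ 69 ∧
    2 * m ^ 69 ≤ 2 ^ (m - 1) := by
  have hlim := tendsto_pow_const_div_const_pow_of_one_lt 69 (r := (2 : ℝ)) (by norm_num)
  obtain ⟨m₁, hm₁⟩ := Filter.eventually_atTop.1
    (hlim.eventually (gt_mem_nhds (by norm_num : (0 : ℝ) < 1 / 4)))
  refine ⟨max m₁ (64 * (2 * S + 20) ^ 3), fun m hm => ?_⟩
  have hm1 : m₁ ≤ m := (le_max_left _ _).trans hm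
  have hm2 : 64 * (2 * S + 20) ^ 3 ≤ m := (le_max_right _ _).trans hm
  set B := 2 * S + 20 with hB
  have hA : 2 * S + 12 + 8 = B := by omega
  set A := 2 * S + 12 with hA'
  have hB20 : 20 ≤ B := by omega
  have hBm : 64 * B ≤ m := le_trans (by nlinarith [Nat.pow_le_pow_left hB20 2]) hm2
  have hm0 : 1280 ≤ m := by omega
  have hpos : 0 < m := by omega
  have h3 : 3 ≤ 3 ^ m := by
    calc 3 = 3 ^ 1 := by norm_num
      _ ≤ 3 ^ m := Nat.pow_le_pow_right (by norm_num) hpos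
  have h27 : 729 ≤ 3 ^ m := by
    calc 729 = 3 ^ 6 := by norm_num
      _ ≤ 3 ^ m := Nat.pow_le_pow_right (by norm_num) (by omega)
  have hx3 : 3 ^ (3 * m) = (3 ^ m) ^ 3 := by rw [← pow_mul, mul_comm]
  have hxA : 3 ^ (A * m) = (3 ^ m) ^ A := by rw [← pow_mul, mul_comm]
  have hxB : 3 ^ (B * m) = (3 ^ m) ^ B := by rw [← pow_mul, mul_comm]
  have hmp : ∀ {i j : ℕ}, i ≤ j → m ^ i ≤ m ^ j := fun h => Nat.pow_le_pow_right hpos h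
  have hstep : ∀ i c : ℕ, c ≤ m → c * m ^ i ≤ m ^ (i + 1) := fun i c h => by
    rw [pow_succ, mul_comm]
    exact Nat.mul_le_mul_left _ h
  have hdouble : ∀ e : ℕ, 3 ^ e + 3 ^ e ≤ 3 ^ (e + 1) := fun e => by
    rw [pow_succ]
    omega
  refine ⟨?_, ?_, ?_, hmp (by norm_num), ?_, ?_, ?_, ?_, ?_, ?_, ?_⟩
  · have h1 : 2 * 3 ^ (3 * m) + 4 ≤ 2 * 3 ^ (4 * m) := by
      have : 3 ^ (4 * m) = 3 ^ m * 3 ^ (3 * m) := by rw [← pow_add]; congr 1; ring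
      rw [this]
      have h4 : 1 ≤ 3 ^ (3 * m) := Nat.one_le_pow _ _ (by norm_num)
      nlinarith
    calc (2 * 3 ^ (3 * m) + 4) * 3 ^ (16 * m) ≤ 2 * 3 ^ (4 * m) * 3 ^ (16 * m) :=
          Nat.mul_le_mul_right _ h1
      _ = 2 * (3 ^ 5) ^ (4 * m) := by rw [← pow_mul, mul_assoc, ← pow_add]; congr 2; ring
      _ ≤ 2 * (4 ^ 4) ^ (4 * m) :=
        Nat.mul_le_mul_left _ (Nat.pow_le_pow_left (by norm_num) _)
      _ = 2 * 4 ^ (16 * m) := by rw [← pow_mul]; congr 2; ring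
  · rw [hxA, show A = (2 * S + 10) + 2 by omega, pow_add _ (2 * S + 10)]
    have h1 : 1 ≤ (3 ^ m) ^ (2 * S + 10) := Nat.one_le_pow _ _ (by omega)
    have h4 : 6 ≤ (3 ^ m) ^ 2 := by nlinarith
    exact (show _ ≤ (3 ^ m) ^ (2 * S + 10) * 6 by omega).trans <|
      Nat.mul_le_mul_left _ h4
  · intro k hk
    rw [hxB, hx3, show B = 2 * S + 9 + 11 by omega]
    set x := 3 ^ m
    have hM : x ^ 3 + 1 ≤ 2 * x ^ 3 := by
      have : 1 ≤ x ^ 3 := Nat.one_le_pow _ _ (by omega)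
      omega
    calc k + k ^ 2 * ((30 * (x ^ 3 + 1) ^ 2 + 2) * (8 * (x ^ 3 + 1)))
        ≤ (2 * x ^ S) ^ 2 + (2 * x ^ S) ^ 2 * ((30 * (2 * x ^ 3) ^ 2 + 2) * (8 * (2 * x ^ 3))) := by
          have h1 : k ≤ (2 * x ^ S) ^ 2 := hk.trans (Nat.le_self_pow (by norm_num) _)
          gcongr
      _ ≤ 4 * x ^ (2 * S) * (x ^ 9 + (120 * x ^ 6 + 2 * x ^ 6) * (16 * x ^ 3)) := by
          have h1 : 1 ≤ x ^ 9 := Nat.one_le_pow _ _ (by omega)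
          have h2 : 1 ≤ x ^ 6 := Nat.one_le_pow _ _ (by omega)
          have h4 : (2 * x ^ S) ^ 2 = 4 * x ^ (2 * S) := by rw [mul_pow, ← pow_mul]; ring
          rw [h4, mul_add]
          have h5 : 30 * (2 * x ^ 3) ^ 2 + 2 ≤ 120 * x ^ 6 + 2 * x ^ 6 := by
            have : (2 * x ^ 3) ^ 2 = 4 * x ^ 6 := by ring
            omega
          have h6 : 8 * (2 * x ^ 3) = 16 * x ^ 3 := by ring
          rw [h6]
          exact Nat.add_le_add (Nat.le_mul_of_pos_right _ h1)
            (Nat.mul_le_mul_left _ (Nat.mul_le_mul_right _ h5))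
      _ = 7812 * x ^ (2 * S + 9) := by rw [pow_add]; ring
      _ ≤ x ^ 2 * x ^ (2 * S + 9) := by gcongr; nlinarith
      _ ≤ x ^ 11 * x ^ (2 * S + 9) :=
          Nat.mul_le_mul_right _ (Nat.pow_le_pow_right (by omega) (by norm_num))
      _ = x ^ (2 * S + 9 + 11) := by ring
  · rw [← pow_mul, ← pow_add]
    calc 3 ^ (B * m) + 3 ^ (B * m + A * m * m ^ 4)
        ≤ 3 ^ (B * m + A * m * m ^ 4) + 3 ^ (B * m + A * m * m ^ 4) :=
          Nat.add_le_add_right (Nat.pow_le_pow_right (by norm_num) (Nat.le_add_right _ _)) _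
      _ ≤ 3 ^ (B * m + A * m * m ^ 4 + 1) := hdouble _
      _ ≤ 3 ^ m ^ 6 := by
        refine Nat.pow_le_pow_right (by norm_num) ?_
        have h1 : A * m * m ^ 4 = A * m ^ 5 := by ring
        have h2 : (A + B + 1) * m ^ 5 ≤ m ^ 6 := hstep 5 _ (by omega)
        have h4 : B * m ≤ B * m ^ 5 := Nat.mul_le_mul_left _ (Nat.le_self_pow (by norm_num) _)
        have h5 : 1 ≤ m ^ 5 := Nat.one_le_pow _ _ hpos
        rw [add_mul, add_mul, one_mul] at h2
        omega
  · rw [← pow_mul, ← pow_add]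
    calc 3 ^ (B * m + A * m * (m ^ 4 + m ^ 19 + 16 * m * m ^ 4)) + 1
        ≤ 3 ^ (B * m + A * m * (m ^ 4 + m ^ 19 + 16 * m * m ^ 4) + 1) :=
          (Nat.add_le_add_left (Nat.one_le_pow _ _ (by norm_num)) _).trans (hdouble _)
      _ ≤ 3 ^ m ^ 22 := by
        refine Nat.pow_le_pow_right (by norm_num) ?_
        have h1 : m ^ 4 + m ^ 19 + 16 * m * m ^ 4 ≤ 18 * m ^ 19 := by
          have e1 := hmp (show 4 ≤ 19 by norm_num)
          have e2 := hmp (show 5 ≤ 19 by norm_num)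
          have e3 : 16 * m * m ^ 4 = 16 * m ^ 5 := by ring
          omega
        have h2 : (18 * A + B + 1) * m ^ 20 ≤ m ^ 21 := hstep 20 _ (by omega)
        have h4 : B * m ≤ B * m ^ 20 := Nat.mul_le_mul_left _ (Nat.le_self_pow (by norm_num) _)
        have h5 : 1 ≤ m ^ 20 := Nat.one_le_pow _ _ hpos
        have h6 : A * m * (m ^ 4 + m ^ 19 + 16 * m * m ^ 4) ≤ 18 * A * m ^ 20 := by
          calc A * m * (m ^ 4 + m ^ 19 + 16 * m * m ^ 4) ≤ A * m * (18 * m ^ 19) :=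
                Nat.mul_le_mul_left _ h1
            _ = 18 * A * m ^ 20 := by ring
        have h7 := hmp (show 21 ≤ 22 by norm_num)
        rw [add_mul, add_mul, one_mul] at h2
        omega
  · calc (4 * (B * m)) ^ 3 = 64 * B ^ 3 * m ^ 3 := by ring
      _ ≤ m ^ 4 := hstep 3 _ hm2
  · calc (4 * m ^ 6) ^ 3 = 64 * m ^ 18 := by ring
      _ ≤ m ^ 19 := hstep 18 _ (by omega)
  · calc (4 * m ^ 22) ^ 3 = 64 * m ^ 66 := by ring
      _ ≤ m ^ 67 := hstep 66 _ (by omega)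
  · rw [← pow_mul, ← pow_add]
    refine Nat.pow_le_pow_right (by norm_num) ?_
    have h1 : m ^ 4 + m ^ 19 + 16 * m * m ^ 4 + m ^ 67 + 1 ≤ 20 * m ^ 67 := by
      have e1 := hmp (show 4 ≤ 67 by norm_num)
      have e2 := hmp (show 5 ≤ 67 by norm_num)
      have e4 := hmp (show 19 ≤ 67 by norm_num)
      have e3 : 16 * m * m ^ 4 = 16 * m ^ 5 := by ring
      have e5 : 1 ≤ m ^ 67 := Nat.one_le_pow _ _ hpos
      omega
    have h2 : (20 * A + B) * m ^ 68 ≤ m ^ 69 := hstep 68 _ (by omega)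
    have h4 : B * m ≤ B * m ^ 68 := Nat.mul_le_mul_left _ (Nat.le_self_pow (by norm_num) _)
    have h6 : A * m * (m ^ 4 + m ^ 19 + 16 * m * m ^ 4 + m ^ 67 + 1) ≤ 20 * A * m ^ 68 := by
      calc A * m * (m ^ 4 + m ^ 19 + 16 * m * m ^ 4 + m ^ 67 + 1) ≤ A * m * (20 * m ^ 67) :=
            Nat.mul_le_mul_left _ h1
        _ = 20 * A * m ^ 68 := by ring
    rw [add_mul] at h2
    omega
  · have h := hm₁ m hm1
    rw [div_lt_iff₀ (by positivity)] at h
    have h2 : (2 : ℝ) ^ m = 2 * 2 ^ (m - 1) := by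
      rw [← pow_succ']
      congr 1
      omega
    rw [h2] at h
    have h5 : (2 : ℝ) * (m : ℝ) ^ 69 ≤ 2 ^ (m - 1) := by linarith
    exact_mod_cast h5

theorem log_three_pow_le {e R : ℕ} (h : (4 * e) ^ 3 ≤ R) :
    (2 * Real.log ((3 ^ e : ℕ) : ℝ)) ^ 3 ≤ (R : ℝ) := by
  have h3 : Real.log 3 ≤ 2 := by
    have := Real.log_le_sub_one_of_pos (show (0 : ℝ) < 3 by norm_num)
    linarith
  have hlog : Real.log ((3 ^ e : ℕ) : ℝ) ≤ 2 * e := by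
    rw [Nat.cast_pow, Real.log_pow, mul_comm]
    exact mul_le_mul_of_nonneg_right h3 (Nat.cast_nonneg e)
  have h0 : 0 ≤ Real.log ((3 ^ e : ℕ) : ℝ) := Real.log_natCast_nonneg _
  calc (2 * Real.log ((3 ^ e : ℕ) : ℝ)) ^ 3 ≤ (4 * (e : ℝ)) ^ 3 :=
        pow_le_pow_left₀ (by linarith) (by linarith) 3
    _ ≤ (R : ℝ) := by exact_mod_cast h

theorem three_pow_lt_of_lt_log {n e : ℕ} (hn : 0 < n) (h : 2 * (e : ℝ) < Real.log n) :
    3 ^ e < n := by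
  have h3 : Real.log 3 ≤ 2 := by
    have := Real.log_le_sub_one_of_pos (show (0 : ℝ) < 3 by norm_num)
    linarith
  have h1 : Real.log ((3 : ℝ) ^ e) < Real.log n := by
    rw [Real.log_pow]
    nlinarith [(Nat.cast_nonneg e : (0 : ℝ) ≤ e)]
  have h2 := (Real.log_lt_log_iff (by positivity) (by exact_mod_cast hn)).1 h1
  exact_mod_cast h2

/-- Rounding `log L` up gives an exponent `m` for which `3 ^ m` is an upper bound for `L`, while
`2 ^ (m - 1)` is a lower bound. -/
theorem exists_exponent {L : ℝ} {m₀ : ℕ} (h : Real.exp m₀ < L) :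
    ∃ m : ℕ, m₀ ≤ m ∧ L ≤ 3 ^ m ∧ 2 ^ (m - 1) < L := by
  have hL : 0 < L := (Real.exp_pos _).trans h
  have hlog : (m₀ : ℝ) < Real.log L := (Real.lt_log_iff_exp_lt hL).2 h
  have hpos : 0 < Real.log L := lt_of_le_of_lt (Nat.cast_nonneg _) hlog
  have hc : 0 < ⌈Real.log L⌉₊ := Nat.ceil_pos.2 hpos
  refine ⟨⌈Real.log L⌉₊, ?_, ?_, ?_⟩
  · exact_mod_cast hlog.le.trans (Nat.le_ceil _)
  · calc L = Real.exp (Real.log L) := (Real.exp_log hL).symm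
      _ ≤ Real.exp (⌈Real.log L⌉₊ : ℝ) := Real.exp_le_exp.2 (Nat.le_ceil _)
      _ = Real.exp 1 ^ ⌈Real.log L⌉₊ := (Real.exp_one_pow _).symm
      _ ≤ 3 ^ ⌈Real.log L⌉₊ := by
        have := Real.exp_one_lt_d9
        gcongr
        linarith
  · have h1 : ((⌈Real.log L⌉₊ - 1 : ℕ) : ℝ) < Real.log L := by
      have := Nat.ceil_lt_add_one hpos.le
      rw [Nat.cast_sub hc, Nat.cast_one]
      linarith
    calc (2 : ℝ) ^ (⌈Real.log L⌉₊ - 1) ≤ Real.exp 1 ^ (⌈Real.log L⌉₊ - 1) := by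
          have := Real.add_one_le_exp 1
          gcongr
          linarith
      _ = Real.exp ((⌈Real.log L⌉₊ - 1 : ℕ) : ℝ) := Real.exp_one_pow _
      _ < Real.exp (Real.log L) := Real.exp_lt_exp.2 h1
      _ = L := Real.exp_log hL

/-- the sparse case with bounded maximum degree (Lemma 4.5). -/
theorem statement9 :
    ∃ ε₁ : ℝ, 0 < ε₁ ∧
      ∀ ε₂ : ℝ, 0 < ε₂ → ε₂ < 1 / 5 → ∀ s : ℝ, 20 ≤ s →
        ∃ (d₀ t₄ : ℝ), 0 < t₄ ∧ t₄ < 1 / 3 ∧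
          ∀ (n : ℕ) (d : ℝ), d₀ ≤ d → d ≤ n → d < 2 * Real.log n ^ s →
            ∀ (V : Type) [Fintype V] (G : SimpleGraph V), Nat.card V = n →
              ¬ ContainsBalSub G ⌈d / 2⌉₊ 2 →
              IsBip G → IsExpander G ε₁ (ε₂ * d) → MinDegGE G d →
              (∀ v : V, ((G.neighborSet v).ncard : ℝ) ≤ d ^ 2 * Real.log n ^ 10) →
              ∃ (k ℓ : ℕ), t₄ * d ≤ (k : ℝ) ∧ ContainsBalSub G k ℓ := by
  refine ⟨4, by norm_num, fun ε hε hε' s hs => ?_⟩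
  obtain ⟨m₀, hm₀⟩ := exists_hierarchy ⌈s⌉₊
  refine ⟨max (18000 / ε) (2 * Real.exp m₀ ^ s), ε / 14400, by positivity, by linarith, ?_⟩
  intro n d hd₀ hdn hds V _ G hn _ hG hexp hdeg hmax
  have hεd : 18000 ≤ ε * d := by
    have := (div_le_iff₀ hε).1 ((le_max_left _ _).trans hd₀)
    linarith
  have hd0 : 0 < d := by
    by_contra! h
    nlinarith
  have hs0 : 0 ≤ s := by linarith
  have hL0 : 0 ≤ Real.log n := Real.log_natCast_nonneg n
  have hn0 : 0 < n := by exact_mod_cast hd0.trans_le hdn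
  have hL : Real.exp m₀ < Real.log n := by
    by_contra! h
    have h1 := Real.rpow_le_rpow hL0 h hs0
    have h2 := (le_max_right _ _).trans hd₀
    linarith
  obtain ⟨m, hm, hLm, hmL⟩ := exists_exponent hL
  obtain ⟨hshrink, hD, hk, hR, hN₂, hN₃, hlog₁, hlog₂, hlog₃, hcard, hpow⟩ := hm₀ m hm
  have h3m : (1 : ℝ) ≤ 3 ^ m := one_le_pow₀ (by norm_num)
  have hdm : d ≤ 2 * (3 ^ m) ^ ⌈s⌉₊ := by
    have h1 : Real.log n ^ s ≤ ((3 : ℝ) ^ m) ^ s := Real.rpow_le_rpow hL0 hLm hs0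
    have h2 : ((3 : ℝ) ^ m) ^ s ≤ ((3 : ℝ) ^ m) ^ (⌈s⌉₊ : ℝ) :=
      Real.rpow_le_rpow_of_exponent_le h3m (Nat.le_ceil s)
    rw [Real.rpow_natCast] at h2
    linarith
  have hkd : ⌈ε / 14400 * d⌉₊ ≤ 2 * (3 ^ m) ^ ⌈s⌉₊ := by
    refine Nat.ceil_le.2 ?_
    push_cast
    nlinarith
  have hkQ : 2 * ⌈ε / 14400 * d⌉₊ ≤ ⌊ε / 1800 * d⌋₊ := by
    refine Nat.le_floor ?_
    have := Nat.ceil_lt_add_one (show 0 ≤ ε / 14400 * d by positivity)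
    push_cast
    linarith
  have hlarge : 3 ^ m ^ 69 < n := by
    refine three_pow_lt_of_lt_log hn0 (lt_of_le_of_lt ?_ hmL)
    exact_mod_cast hpow
  have hS : Scales G ε d (3 ^ (3 * m) + 1) (3 ^ ((2 * ⌈s⌉₊ + 12) * m)) (m ^ 4) (m ^ 19) (m ^ 67)
      (3 ^ ((2 * ⌈s⌉₊ + 20) * m)) (3 ^ m ^ 6) (3 ^ m ^ 22) (16 * m) ⌊ε / 1800 * d⌋₊ :=
    { eps_pos := hε
      eps_lt := hε'
      le_mul := by linarith
      expander := hexp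
      minDeg := hdeg
      log_lt := by
        rw [hn]
        have h1 : Real.log n ^ 3 ≤ (3 ^ m) ^ 3 := pow_le_pow_left₀ hL0 hLm 3
        have h2 : ((3 : ℝ) ^ m) ^ 3 = 3 ^ (3 * m) := by rw [← pow_mul, mul_comm]
        push_cast
        linarith
      deg_lt := fun v => by
        have h1 : d ^ 2 * Real.log n ^ 10 ≤ (2 * (3 ^ m) ^ ⌈s⌉₊) ^ 2 * (3 ^ m) ^ 10 := by gcongr
        have h2 : ((2 : ℝ) * (3 ^ m) ^ ⌈s⌉₊) ^ 2 * (3 ^ m) ^ 10 =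
            4 * (3 ^ m) ^ (2 * ⌈s⌉₊ + 10) := by
          rw [mul_pow, ← pow_mul _ ⌈s⌉₊, mul_comm ⌈s⌉₊, pow_add _ (2 * ⌈s⌉₊)]
          ring
        have h3 : (G.neighborSet v).ncard ≤ 4 * (3 ^ m) ^ (2 * ⌈s⌉₊ + 10) := by
          have := (hmax v).trans (h1.trans_eq h2)
          exact_mod_cast this
        omega
      one_le := Nat.one_le_pow _ _ (by norm_num)
      radius_le := hR
      size_two := hN₂
      size_three := hN₃
      log_one := log_three_pow_le hlog₁
      log_two := log_three_pow_le hlog₂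
      log_three := log_three_pow_le hlog₃
      lt_card := hcard.trans_lt (hn ▸ hlarge)
      shrink := by
        rw [show 2 * (3 ^ (3 * m) + 1) + 2 = 2 * 3 ^ (3 * m) + 4 by ring]
        exact hshrink
      six_le := Nat.le_floor (by push_cast; linarith)
      thin_le := Nat.floor_le (by positivity) }
  exact ⟨_, _, Nat.le_ceil _, hS.containsBalSub hG hkQ (hk _ hkd)⟩

end Balanced
end

section
/- Let 0 < ε₁ < 1 and 0 < ε₂ < 1 and let t₂ > 0 satisfy t₂ ≤ ε₁·ε₂/(8·log²(15/2)). Then for all sufficiently large n ≥ d the following holds: if G is an n-vertex bipartite (ε₁, ε₂·d)-expander with minimum degree δ(G) ≥ d, and L ⊆ V(G) satisfies |L| < 2·t₂·d, then the induced subgraph H = G − L is a bipartite (ε₁/2, ε₂·d)-expander with δ(H) > d/3 and |V(H)| > n/3. -/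
open Real

namespace Balanced

variable {V : Type*}

/-- The numerical bound `exp 2 ≤ 15 / 2`. -/
theorem exp_two_le : Real.exp 2 ≤ 15 / 2 := by
  have h := Real.exp_one_lt_d9
  have h0 := Real.exp_pos 1
  have : Real.exp 2 = Real.exp 1 * Real.exp 1 := by rw [← Real.exp_add]; norm_num
  rw [this]
  nlinarith

theorem two_le_log : 2 ≤ Real.log (15 / 2) :=
  (Real.le_log_iff_exp_le (by norm_num)).2 exp_two_le

/-- The function `y / log² y` is monotone from `15 / 2` on. -/
theorem sq_log_mul_le {y : ℝ} (hy : 15 / 2 ≤ y) :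
    15 / 2 * Real.log y ^ 2 ≤ y * Real.log (15 / 2) ^ 2 := by
  have hy0 : 0 < y := by linarith
  have h := Real.log_div_sqrt_antitoneOn exp_two_le (exp_two_le.trans hy) hy
  have h2 := pow_le_pow_left₀
    (div_nonneg (Real.log_nonneg (by linarith)) (Real.sqrt_nonneg y)) h 2
  rw [div_pow, div_pow, Real.sq_sqrt hy0.le, Real.sq_sqrt (by norm_num),
    div_le_div_iff₀ hy0 (by norm_num)] at h2
  linarith

/-- Sets of size at least `k / 2` are guaranteed at least the expansion of sets of size `k / 2`. -/
theorem le_epsFn_mul {ε k x : ℝ} (hε : 0 < ε) (hk : 0 < k) (hx : k / 2 ≤ x) :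
    ε * k / (2 * Real.log (15 / 2) ^ 2) ≤ epsFn ε k x * x := by
  have hy : 15 / 2 ≤ 15 * x / k := by rw [le_div_iff₀ hk]; linarith
  have hm := sq_log_mul_le hy
  have hl : 0 < Real.log (15 * x / k) := Real.log_pos (by linarith)
  have ha : 0 < Real.log (15 / 2) := Real.log_pos (by norm_num)
  rw [epsFn, if_neg (by linarith), div_mul_eq_mul_div, div_le_div_iff₀ (by positivity)
    (by positivity)]
  have h3 : k * Real.log (15 * x / k) ^ 2 ≤ x * (2 * Real.log (15 / 2) ^ 2) := by
    rw [div_mul_eq_mul_div (15 * x), le_div_iff₀ hk] at hm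
    linarith
  calc ε * k * Real.log (15 * x / k) ^ 2 = ε * (k * Real.log (15 * x / k) ^ 2) := by ring
    _ ≤ ε * (x * (2 * Real.log (15 / 2) ^ 2)) := by gcongr
    _ = _ := by ring

theorem epsFn_half (ε k x : ℝ) : epsFn (ε / 2) k x = epsFn ε k x / 2 := by
  unfold epsFn
  split_ifs <;> ring

theorem ncard_le_ncard_preimage_add [Finite V] (S L : Set V) :
    S.ncard ≤ ((↑) ⁻¹' S : Set ↥(Lᶜ)).ncard + L.ncard := by
  have h : S ⊆ Subtype.val '' ((↑) ⁻¹' S : Set ↥(Lᶜ)) ∪ L := by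
    intro v hv
    by_cases hL : v ∈ L
    · exact Or.inr hL
    · exact Or.inl ⟨⟨v, hL⟩, hv, rfl⟩
  have h2 := Set.ncard_le_ncard h (Set.toFinite _)
  have h3 := Set.ncard_union_le (Subtype.val '' ((↑) ⁻¹' S : Set ↥(Lᶜ))) L
  rw [Set.ncard_image_of_injective _ Subtype.val_injective] at h3
  exact h2.trans h3

theorem preimage_extNbr_subset (G : SimpleGraph V) (L : Set V) (X : Set ↥(Lᶜ)) :
    ((↑) ⁻¹' extNbr G (Subtype.val '' X) : Set ↥(Lᶜ)) ⊆ extNbr (G.induce Lᶜ) X := by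
  rintro v ⟨hv, _, ⟨u, hu, rfl⟩, huv⟩
  exact ⟨fun h => hv ⟨v, h, rfl⟩, u, hu, huv⟩

theorem IsBip.induce {G : SimpleGraph V} (hG : IsBip G) (S : Set V) : IsBip (G.induce S) :=
  let ⟨f, hf⟩ := hG
  ⟨fun v => f v, fun u v h => hf u v h⟩

/-- Removing a set which is small compared to `k` from an `(ε, k)`-expander leaves
an `(ε / 2, k)`-expander. -/
theorem IsExpander.induce_compl [Finite V] {G : SimpleGraph V} {ε k : ℝ} (hG : IsExpander G ε k)
    (hε : 0 < ε) (hk : 0 < k) {L : Set V}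
    (hL : (L.ncard : ℝ) ≤ ε * k / (4 * Real.log (15 / 2) ^ 2)) :
    IsExpander (G.induce Lᶜ) (ε / 2) k := by
  intro X hX1 hX2
  have hcard : (Subtype.val '' X).ncard = X.ncard :=
    Set.ncard_image_of_injective _ Subtype.val_injective
  have hV : (Nat.card ↥(Lᶜ) : ℝ) ≤ Nat.card V := by
    exact_mod_cast Nat.card_le_card_of_injective _ Subtype.val_injective
  have h1 := hG (Subtype.val '' X) (by rwa [hcard]) (by rw [hcard]; linarith)
  rw [hcard] at h1
  have h2 := (ncard_le_ncard_preimage_add (extNbr G (Subtype.val '' X)) L).trans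
    (Nat.add_le_add_right
      (Set.ncard_le_ncard (preimage_extNbr_subset G L X) (Set.toFinite _)) _)
  have h3 : ((extNbr G (Subtype.val '' X)).ncard : ℝ) ≤
      (extNbr (G.induce Lᶜ) X).ncard + L.ncard := by exact_mod_cast h2
  have h4 := le_epsFn_mul hε hk hX1
  have h5 : ε * k / (4 * Real.log (15 / 2) ^ 2) =
      ε * k / (2 * Real.log (15 / 2) ^ 2) / 2 := by
    rw [div_div]; ring
  rw [epsFn_half]
  linarith

/-- removing few vertices keeps a dense expander (the Claim in the
proof of Lemma 4.1). -/
theorem statement10 :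
    ∀ ε₁ ε₂ t₂ : ℝ, 0 < ε₁ → ε₁ < 1 → 0 < ε₂ → ε₂ < 1 → 0 < t₂ →
      t₂ ≤ ε₁ * ε₂ / (8 * Real.log (15 / 2) ^ 2) →
      ∃ d₀ : ℝ, ∀ (n : ℕ) (d : ℝ), d₀ ≤ d → d ≤ n →
        ∀ (V : Type) [Fintype V] (G : SimpleGraph V), Nat.card V = n →
          IsBip G → IsExpander G ε₁ (ε₂ * d) → MinDegGE G d →
            ∀ L : Set V, (L.ncard : ℝ) < 2 * t₂ * d →
              IsBip (G.induce Lᶜ) ∧ IsExpander (G.induce Lᶜ) (ε₁ / 2) (ε₂ * d) ∧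
                (∀ v : ↥(Lᶜ), d / 3 < (((G.induce Lᶜ).neighborSet v).ncard : ℝ)) ∧
                (n : ℝ) / 3 < (Nat.card ↥(Lᶜ) : ℝ) := by
  intro ε₁ ε₂ t₂ hε₁ hε₁' hε₂ hε₂' _ ht
  refine ⟨1, fun n d hd hdn V _ G hn hbip hexp hdeg L hL => ?_⟩
  have ha := two_le_log
  have ha2 : 4 ≤ Real.log (15 / 2) ^ 2 := by nlinarith
  have hLk : (L.ncard : ℝ) ≤ ε₁ * (ε₂ * d) / (4 * Real.log (15 / 2) ^ 2) := by
    refine hL.le.trans ?_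
    rw [le_div_iff₀ (by positivity)] at ht ⊢
    nlinarith
  have hLd : (L.ncard : ℝ) ≤ d / 16 := by
    refine hLk.trans ?_
    have hε : ε₁ * ε₂ ≤ 1 := mul_le_one₀ hε₁'.le hε₂.le hε₂'.le
    rw [div_le_div_iff₀ (by positivity) (by norm_num)]
    nlinarith
  refine ⟨hbip.induce _, hexp.induce_compl hε₁ (by positivity) hLk, fun v => ?_, ?_⟩
  · have h1 : ((G.neighborSet v).ncard : ℝ) ≤
        ((G.induce Lᶜ).neighborSet v).ncard + L.ncard := by
      exact_mod_cast ncard_le_ncard_preimage_add (G.neighborSet v) L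
    have h2 := hdeg v
    linarith
  · have h1 : (n : ℝ) = L.ncard + Nat.card ↥(Lᶜ) := by
      rw [← hn, Nat.card_coe_set_eq]
      exact_mod_cast (Set.ncard_add_ncard_compl L).symm
    linarith

end Balanced
end

section
/- There exists some ε₁ > 0 such that the following holds for every k > 0: every finite graph G has an (ε₁, k)-expander subgraph H with average degree d(H) ≥ d(G)/2 and minimum degree δ(H) ≥ d(H)/2. -/
open Real

namespace Balanced

variable {V : Type*}

/-- A slowly increasing weight with values in `[1, 2]`; the expander is a maximiser of the average
degree divided by this weight of the order. -/
noncomputable def wt (k x : ℝ) : ℝ := 2 - 1 / max 1 (Real.log (15 * x / k))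

lemma one_le_wt (k x : ℝ) : 1 ≤ wt k x := by
  have h : 1 / max 1 (Real.log (15 * x / k)) ≤ 1 := by
    rw [div_le_one (by positivity)]; exact le_max_left _ _
  unfold wt; linarith

lemma wt_le_two (k x : ℝ) : wt k x ≤ 2 := by
  have h : 0 ≤ 1 / max 1 (Real.log (15 * x / k)) := by positivity
  unfold wt; linarith

lemma wt_mono {k x y : ℝ} (hk : 0 < k) (hx : 0 < x) (hxy : x ≤ y) : wt k x ≤ wt k y := by
  unfold wt
  gcongr

lemma one_le_log_fifteen_mul {k x : ℝ} (hk : 0 < k) (hx : k / 2 ≤ x) :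
    1 ≤ Real.log (15 * x / k) := by
  rw [Real.le_log_iff_exp_le (by have : 0 < x := by linarith
                                 positivity)]
  have h : (7.5 : ℝ) ≤ 15 * x / k := by rw [le_div_iff₀ hk]; linarith
  linarith [Real.exp_one_lt_d9]

lemma wt_mul {k x c : ℝ} (hk : 0 < k) (hx : k / 2 ≤ x) (hc : 1 ≤ c) :
    wt k (c * x) = 2 - 1 / (Real.log c + Real.log (15 * x / k)) := by
  have hx0 : 0 < x := by linarith
  have h : 15 * (c * x) / k = c * (15 * x / k) := by ring
  rw [wt, h, Real.log_mul (by positivity) (by positivity), max_eq_right]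
  linarith [Real.log_nonneg hc, one_le_log_fifteen_mul hk hx]

lemma wt_gap {k x : ℝ} (hk : 0 < k) (hx : k / 2 ≤ x) :
    wt k (3 / 2 * x) + 1 / 16 / Real.log (15 * x / k) ^ 2 ≤ wt k (2 * x) := by
  rw [wt_mul hk hx (by norm_num), wt_mul hk hx (by norm_num)]
  have hL := one_le_log_fifteen_mul hk hx
  set L := Real.log (15 * x / k)
  have h2 : Real.log 2 < 1 := by linarith [Real.log_two_lt_d9]
  have h32 : 0 ≤ Real.log (3 / 2) := Real.log_nonneg (by norm_num)
  have hgap : 1 / 4 ≤ Real.log 2 - Real.log (3 / 2) := by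
    rw [← Real.log_div (by norm_num) (by norm_num)]
    have := Real.one_sub_inv_le_log_of_pos (x := 2 / (3 / 2)) (by norm_num)
    norm_num at this ⊢
    linarith
  set a := Real.log 2
  set b := Real.log (3 / 2)
  have hb : 0 < b + L := by linarith
  have ha : 0 < a + L := by linarith
  have h1 : 1 / (b + L) - 1 / (a + L) = (a - b) / ((b + L) * (a + L)) := by
    field_simp; ring
  have h3 : 1 / 16 / L ^ 2 ≤ (a - b) / ((b + L) * (a + L)) := by
    rw [div_div, div_le_div_iff₀ (by positivity) (by positivity)]
    have h4 : (b + L) * (a + L) ≤ (2 * L) * (2 * L) := by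
      apply mul_le_mul <;> linarith
    nlinarith [sq_nonneg L]
  linarith

lemma wt_superadditive {k x n ν : ℝ} (hk : 0 < k) (hx : k / 2 ≤ x) (hn : 2 * x ≤ n)
    (hν : 0 ≤ ν) (hlt : ν < 1 / 100 / Real.log (15 * x / k) ^ 2 * x) :
    (x + ν) * wt k (x + ν) + (n - x) * wt k (n - x) < n * wt k n := by
  have hx0 : 0 < x := by linarith
  have hL := one_le_log_fifteen_mul hk hx
  have hgap := wt_gap hk hx
  set L := Real.log (15 * x / k)
  have hL2 : 1 / 100 / L ^ 2 ≤ 1 / 100 := div_le_self (by norm_num) (one_le_pow₀ hL)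
  have hνx : ν ≤ x / 2 := by nlinarith
  have h1 : wt k (x + ν) ≤ wt k (3 / 2 * x) := wt_mono hk (by linarith) (by linarith)
  have h2 : wt k (2 * x) ≤ wt k n := wt_mono hk (by linarith) hn
  have h3 : wt k (n - x) ≤ wt k n := wt_mono hk (by linarith) (by linarith)
  have h4 := wt_le_two k (x + ν)
  have h5 : x * (wt k (x + ν) + 1 / 16 / L ^ 2) ≤ x * wt k n := by
    apply mul_le_mul_of_nonneg_left _ hx0.le; linarith
  have h6 : (n - x) * wt k (n - x) ≤ (n - x) * wt k n := by
    apply mul_le_mul_of_nonneg_left h3; linarith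
  have h7 : ν * wt k (x + ν) ≤ ν * 2 := mul_le_mul_of_nonneg_left h4 hν
  have h8 : 1 / 100 / L ^ 2 * x = 16 / 100 * (x * (1 / 16 / L ^ 2)) := by ring
  have h9 : 0 < x * (1 / 16 / L ^ 2) := by positivity
  nlinarith

open Classical in
/-- The number of ordered pairs of adjacent vertices of `S`. -/
noncomputable def pairCount (G : SimpleGraph V) (S : Finset V) : ℕ :=
  ((S ×ˢ S).filter fun p => G.Adj p.1 p.2).card

lemma pairCount_le_add (G : SimpleGraph V) (S A B : Finset V)
    (h : ∀ u ∈ S, ∀ v ∈ S, G.Adj u v → (u ∈ A ∧ v ∈ A) ∨ (u ∈ B ∧ v ∈ B)) :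
    pairCount G S ≤ pairCount G A + pairCount G B := by
  classical
  refine le_trans (Finset.card_le_card ?_) (Finset.card_union_le _ _)
  rintro ⟨u, v⟩ hp
  simp only [Finset.mem_filter, Finset.mem_product, Finset.mem_union] at hp ⊢
  have := h u hp.1.1 v hp.1.2 hp.2
  tauto

open Classical in
lemma pairCount_le_erase (G : SimpleGraph V) (S : Finset V) (v : V) :
    pairCount G S ≤ pairCount G (S.erase v) + 2 * (S.filter fun u => G.Adj v u).card := by
  have hsub : ((S ×ˢ S).filter fun p => G.Adj p.1 p.2) ⊆
      (((S.erase v ×ˢ S.erase v).filter fun p => G.Adj p.1 p.2) ∪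
        ((S.filter fun u => G.Adj v u).image fun u => (v, u))) ∪
        ((S.filter fun u => G.Adj v u).image fun u => (u, v)) := by
    rintro ⟨a, b⟩ hp
    simp only [Finset.mem_filter, Finset.mem_product, Finset.mem_union, Finset.mem_erase,
      Finset.mem_image, Prod.mk.injEq] at hp ⊢
    obtain ⟨⟨ha, hb⟩, hab⟩ := hp
    by_cases hav : a = v
    · subst hav
      exact Or.inl (Or.inr ⟨b, ⟨hb, hab⟩, rfl, rfl⟩)
    · by_cases hbv : b = v
      · subst hbv
        exact Or.inr ⟨a, ⟨ha, hab.symm⟩, rfl, rfl⟩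
      · exact Or.inl (Or.inl ⟨⟨⟨hav, ha⟩, hbv, hb⟩, hab⟩)
  have h := Finset.card_le_card hsub
  have h1 := Finset.card_union_le
    (((S.erase v ×ˢ S.erase v).filter fun p => G.Adj p.1 p.2) ∪
        ((S.filter fun u => G.Adj v u).image fun u => (v, u)))
    ((S.filter fun u => G.Adj v u).image fun u => (u, v))
  have h2 := Finset.card_union_le ((S.erase v ×ˢ S.erase v).filter fun p => G.Adj p.1 p.2)
        ((S.filter fun u => G.Adj v u).image fun u => (v, u))
  have h3 := Finset.card_image_le (s := S.filter fun u => G.Adj v u) (f := fun u => (v, u))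
  have h4 := Finset.card_image_le (s := S.filter fun u => G.Adj v u) (f := fun u => (u, v))
  unfold pairCount
  omega

lemma two_mul_card_edgeSet [Fintype V] (G : SimpleGraph V) :
    2 * Nat.card G.edgeSet = pairCount G Finset.univ := by
  classical
  rw [Nat.card_eq_fintype_card, ← SimpleGraph.edgeFinset_card, ← G.dart_card_eq_twice_card_edges,
    pairCount, ← Fintype.card_coe]
  refine Fintype.card_congr ⟨fun d => ⟨d.toProd, by simp [d.adj]⟩,
    fun p => ⟨p.1, (Finset.mem_filter.mp p.2).2⟩, fun _ => rfl, fun _ => rfl⟩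

lemma avgDeg_eq [Fintype V] (G : SimpleGraph V) :
    avgDeg G = (pairCount G Finset.univ : ℝ) / (Finset.univ : Finset V).card := by
  rw [avgDeg, ← two_mul_card_edgeSet, Nat.card_eq_fintype_card (α := V), Finset.card_univ]
  push_cast
  rfl

lemma avgDeg_induce (G : SimpleGraph V) (S : Finset V) :
    avgDeg ((⊤ : G.Subgraph).induce (S : Set V)).coe = (pairCount G S : ℝ) / S.card := by
  classical
  have : Fintype ((⊤ : G.Subgraph).induce (S : Set V)).verts :=
    inferInstanceAs (Fintype (S : Set V))
  rw [avgDeg_eq]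
  congr 2
  · unfold pairCount
    refine Finset.card_bij (fun p _ => (p.1.1, p.2.1)) ?_ ?_ ?_
    · rintro ⟨⟨u, hu⟩, ⟨v, hv⟩⟩ hp
      simp_all
    · rintro ⟨⟨u, hu⟩, ⟨v, hv⟩⟩ hp ⟨⟨u', hu'⟩, ⟨v', hv'⟩⟩ hp' h
      simp_all
    · rintro ⟨u, v⟩ hp
      simp only [Finset.mem_filter, Finset.mem_product] at hp
      exact ⟨(⟨u, hp.1.1⟩, ⟨v, hp.1.2⟩), by simp [hp], rfl⟩
  · rw [Finset.card_univ, ← Nat.card_eq_fintype_card]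
    exact (Nat.card_coe_set_eq (S : Set V)).trans (Set.ncard_coe_finset S)

/-- A vertex set maximising the average degree divided by the weight of the order. -/
lemma exists_maximiser [Fintype V] (G : SimpleGraph V) (k : ℝ) :
    ∃ (M : ℝ) (S : Finset V), (0 < M ∨ S = ∅) ∧ (S.Nonempty ∨ M = 0) ∧ 0 ≤ M ∧
      (∀ T : Finset V, (pairCount G T : ℝ) ≤ M * (T.card * wt k T.card)) ∧
      (pairCount G S : ℝ) = M * (S.card * wt k S.card) := by
  classical
  let f : Finset V → ℝ := fun T => (pairCount G T : ℝ) / (T.card * wt k T.card)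
  obtain ⟨S, -, hS⟩ := Finset.exists_max_image (Finset.univ : Finset (Finset V)) f
    ⟨∅, Finset.mem_univ _⟩
  have hpos : ∀ T : Finset V, T.Nonempty → 0 < (T.card : ℝ) * wt k T.card := fun T hT =>
    mul_pos (by exact_mod_cast hT.card_pos) (by linarith [one_le_wt k T.card])
  have hzero : (pairCount G (∅ : Finset V) : ℝ) = 0 := by simp [pairCount]
  have hM : 0 ≤ f S := div_nonneg (Nat.cast_nonneg _)
    (mul_nonneg (Nat.cast_nonneg _) (by linarith [one_le_wt k S.card]))
  have hmax : ∀ T : Finset V, (pairCount G T : ℝ) ≤ f S * (T.card * wt k T.card) := by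
    intro T
    rcases T.eq_empty_or_nonempty with rfl | hT
    · simp [hzero]
    · rw [← div_le_iff₀ (hpos T hT)]
      exact hS T (Finset.mem_univ _)
  rcases hM.lt_or_eq with h | h
  · have hne : S.Nonempty := by
      rw [Finset.nonempty_iff_ne_empty]
      rintro rfl
      simp [f] at h
    exact ⟨f S, S, Or.inl h, Or.inl hne, hM, hmax, (div_mul_cancel₀ _ (hpos S hne).ne').symm⟩
  · exact ⟨f S, ∅, Or.inr rfl, Or.inr h.symm, hM, hmax, by simp [hzero]⟩

section Maximiser

variable {G : SimpleGraph V} {k M : ℝ} {S : Finset V}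

lemma isExpander_of_maximiser (hk : 0 < k) (hMS : 0 < M ∨ S = ∅)
    (hmax : ∀ T : Finset V, (pairCount G T : ℝ) ≤ M * (T.card * wt k T.card))
    (hS : (pairCount G S : ℝ) = M * (S.card * wt k S.card)) :
    IsExpander ((⊤ : G.Subgraph).induce (S : Set V)).coe (1 / 100) k := by
  classical
  have : Fintype ((⊤ : G.Subgraph).induce (S : Set V)).verts :=
    inferInstanceAs (Fintype (S : Set V))
  intro X hkX hXn
  have hn : Nat.card ((⊤ : G.Subgraph).induce (S : Set V)).verts = S.card :=
    (Nat.card_coe_set_eq (S : Set V)).trans (Set.ncard_coe_finset S)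
  rw [hn] at hXn
  rw [epsFn, if_neg (by linarith)]
  by_contra! hlt
  set N := extNbr ((⊤ : G.Subgraph).induce (S : Set V)).coe X
  have hM : 0 < M := by
    rcases hMS with h | rfl
    · exact h
    · rw [Finset.card_empty, Nat.cast_zero] at hXn; linarith
  have key := wt_superadditive (n := S.card) hk hkX (by linarith) (Nat.cast_nonneg N.ncard) hlt
  let XV : Finset V := X.toFinset.image Subtype.val
  let NV : Finset V := N.toFinset.image Subtype.val
  have hXV : XV.card = X.ncard := by
    rw [Finset.card_image_of_injective _ Subtype.val_injective, Set.ncard_eq_toFinset_card']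
  have hNV : NV.card = N.ncard := by
    rw [Finset.card_image_of_injective _ Subtype.val_injective, Set.ncard_eq_toFinset_card']
  have hXS : XV ⊆ S := by
    intro v hv
    obtain ⟨w, -, rfl⟩ := Finset.mem_image.mp hv
    exact w.2
  have hsplit : pairCount G S ≤ pairCount G (XV ∪ NV) + pairCount G (S \ XV) := by
    have hmem : ∀ u ∈ S, ∀ v ∈ S, G.Adj u v → u ∈ XV → v ∈ XV ∪ NV := by
      intro u hu v hv huv hux
      obtain ⟨w, hw, rfl⟩ := Finset.mem_image.mp hux
      by_cases hvx : (⟨v, hv⟩ : ((⊤ : G.Subgraph).induce (S : Set V)).verts) ∈ X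
      · exact Finset.mem_union_left _ (Finset.mem_image.mpr ⟨_, Set.mem_toFinset.mpr hvx, rfl⟩)
      · refine Finset.mem_union_right _ (Finset.mem_image.mpr
          ⟨⟨v, hv⟩, Set.mem_toFinset.mpr ⟨hvx, w, Set.mem_toFinset.mp hw, ?_⟩, rfl⟩)
        exact ⟨hu, hv, huv⟩
    apply pairCount_le_add
    intro u hu v hv huv
    by_cases hux : u ∈ XV
    · exact Or.inl ⟨Finset.mem_union_left _ hux, hmem u hu v hv huv hux⟩
    · by_cases hvx : v ∈ XV
      · exact Or.inl ⟨hmem v hv u hu huv.symm hvx, Finset.mem_union_left _ hvx⟩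
      · exact Or.inr ⟨Finset.mem_sdiff.mpr ⟨hu, hux⟩, Finset.mem_sdiff.mpr ⟨hv, hvx⟩⟩
  have hsplit' : (pairCount G S : ℝ) ≤ pairCount G (XV ∪ NV) + pairCount G (S \ XV) := by
    exact_mod_cast hsplit
  have hB : ((S \ XV).card : ℝ) = S.card - X.ncard := by
    rw [Finset.card_sdiff_of_subset hXS, Nat.cast_sub (Finset.card_le_card hXS), hXV]
  have hA : ((XV ∪ NV).card : ℝ) ≤ X.ncard + N.ncard := by
    rw [← hXV, ← hNV]
    exact_mod_cast Finset.card_union_le _ _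
  have hA0 : (0 : ℝ) < (XV ∪ NV).card := by
    have : (XV.card : ℝ) ≤ (XV ∪ NV).card := by
      exact_mod_cast Finset.card_le_card Finset.subset_union_left
    rw [hXV] at this
    linarith
  have h1 := hmax (XV ∪ NV)
  have h2 := hmax (S \ XV)
  rw [hB] at h2
  have h3 : ((XV ∪ NV).card : ℝ) * wt k (XV ∪ NV).card ≤
      (X.ncard + N.ncard) * wt k (X.ncard + N.ncard) :=
    mul_le_mul hA (wt_mono hk hA0 hA) (by linarith [one_le_wt k (XV ∪ NV).card]) (by positivity)
  have h4 := mul_le_mul_of_nonneg_left h3 hM.le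
  have h5 := mul_lt_mul_of_pos_left key hM
  rw [mul_add] at h5
  linarith

lemma avgDeg_le_of_maximiser [Fintype V] (hMS : S.Nonempty ∨ M = 0) (hM : 0 ≤ M)
    (hmax : ∀ T : Finset V, (pairCount G T : ℝ) ≤ M * (T.card * wt k T.card))
    (hS : (pairCount G S : ℝ) = M * (S.card * wt k S.card)) :
    avgDeg G / 2 ≤ avgDeg ((⊤ : G.Subgraph).induce (S : Set V)).coe := by
  have hG : avgDeg G ≤ M * 2 := by
    rw [avgDeg_eq]
    refine div_le_of_le_mul₀ (Nat.cast_nonneg _) (by positivity) ((hmax _).trans ?_)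
    rw [mul_assoc, mul_comm (2 : ℝ)]
    gcongr
    exact wt_le_two _ _
  rw [avgDeg_induce]
  rcases hMS with h | rfl
  · have hn : (0 : ℝ) < S.card := by exact_mod_cast h.card_pos
    rw [hS, le_div_iff₀ hn]
    have h1 := mul_le_mul_of_nonneg_left (one_le_wt k S.card) (mul_nonneg hM hn.le)
    nlinarith
  · have : (0 : ℝ) ≤ (pairCount G S : ℝ) / S.card := by positivity
    linarith

lemma minDegGE_of_maximiser (hk : 0 < k) (hM : 0 ≤ M)
    (hmax : ∀ T : Finset V, (pairCount G T : ℝ) ≤ M * (T.card * wt k T.card))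
    (hS : (pairCount G S : ℝ) = M * (S.card * wt k S.card)) :
    MinDegGE ((⊤ : G.Subgraph).induce (S : Set V)).coe
      (avgDeg ((⊤ : G.Subgraph).induce (S : Set V)).coe / 2) := by
  classical
  rintro ⟨v, hv⟩
  have hvS : v ∈ S := hv
  have hn : (0 : ℝ) < S.card := by exact_mod_cast Finset.card_pos.mpr ⟨v, hvS⟩
  have hdeg : ((((⊤ : G.Subgraph).induce (S : Set V)).coe.neighborSet ⟨v, hv⟩).ncard) =
      (S.filter fun u => G.Adj v u).card := by
    rw [← Set.ncard_coe_finset, ← Set.ncard_image_of_injective _ Subtype.val_injective]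
    congr 1
    ext u
    simp [hvS]
    tauto
  rw [hdeg, avgDeg_induce]
  set m := (S.filter fun u => G.Adj v u).card
  set P := pairCount G S
  have h1 : (P : ℝ) ≤ pairCount G (S.erase v) + 2 * m := by
    exact_mod_cast pairCount_le_erase G S v
  have h2 := hmax (S.erase v)
  have h3 : ((S.erase v).card : ℝ) = S.card - 1 := by
    rw [Finset.card_erase_of_mem hvS, Nat.cast_sub (Finset.card_pos.mpr ⟨v, hvS⟩), Nat.cast_one]
  have h4 : ((S.erase v).card : ℝ) * wt k (S.erase v).card ≤ (S.card - 1) * wt k S.card := by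
    rcases (S.erase v).eq_empty_or_nonempty with h | h
    · rw [← h3, h]; simp
    · rw [h3]
      have : (0 : ℝ) < (S.erase v).card := by exact_mod_cast h.card_pos
      rw [h3] at this
      exact mul_le_mul_of_nonneg_left (wt_mono hk this (by linarith)) this.le
  have h5 := mul_le_mul_of_nonneg_left h4 hM
  have h6 : (P : ℝ) / S.card = M * wt k S.card := by
    rw [hS]; field_simp
  rw [h6]
  linarith

end Maximiser

/-- every graph has an expander subgraph of comparable density
(Komlós–Szemerédi, Lemma 2.2). -/
theorem statement11 :
    ∃ ε₁ : ℝ, 0 < ε₁ ∧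
      ∀ k : ℝ, 0 < k →
        ∀ (V : Type) [Fintype V] (G : SimpleGraph V),
          ∃ H : G.Subgraph, IsExpander H.coe ε₁ k ∧
            avgDeg G / 2 ≤ avgDeg H.coe ∧ MinDegGE H.coe (avgDeg H.coe / 2) := by
  refine ⟨1 / 100, by norm_num, fun k hk V _ G => ?_⟩
  obtain ⟨M, S, hMS, hMS', hM, hmax, hS⟩ := exists_maximiser G k
  exact ⟨(⊤ : G.Subgraph).induce (S : Set V), isExpander_of_maximiser hk hMS hmax hS,
    avgDeg_le_of_maximiser hMS' hM hmax hS, minDegGE_of_maximiser hk hM hmax hS⟩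

end Balanced
end

section
/- For each 0 < ε₁ < 1 and 0 < ε₂ < 1, there exists d₀ = d₀(ε₁,ε₂) such that the following holds for each n ≥ d ≥ d₀ and each real x ≥ 1. Let G be an n-vertex (ε₁, ε₂·d)-expander with minimum degree δ(G) ≥ d − 1. Let A, B ⊆ V(G) with |A| ≥ x and |B| ≥ x, and let W ⊆ V(G) \ (A ∪ B) satisfy |W|·log³ n ≤ 10x. Then there is a path from A to B in G − W with length at most (40/ε₁)·log³ n. -/
open Real

namespace Balanced

variable {V : Type*}

lemma ballSetIn_mono (G : SimpleGraph V) (S Y : Set V) {r s : ℕ} (h : r ≤ s) :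
    ballSetIn G S Y r ⊆ ballSetIn G S Y s := by
  rintro u ⟨y, hy, w, hw, hS⟩
  exact ⟨y, hy, w, hw.trans h, hS⟩

lemma subset_ballSetIn (G : SimpleGraph V) {S Y : Set V} (h : Y ⊆ S) (r : ℕ) :
    Y ⊆ ballSetIn G S Y r := by
  intro y hy
  refine ⟨y, hy, .nil, by simp, ?_⟩
  intro x hx
  simp only [SimpleGraph.Walk.support_nil, List.mem_singleton] at hx
  exact hx ▸ h hy

lemma mem_ballSetIn_succ {G : SimpleGraph V} {S Y : Set V} {r : ℕ} {u v : V}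
    (hu : u ∈ ballSetIn G S Y r) (huv : G.Adj u v) (hv : v ∈ S) :
    v ∈ ballSetIn G S Y (r + 1) := by
  obtain ⟨y, hy, w, hw, hS⟩ := hu
  refine ⟨y, hy, w.concat huv, by simpa using hw, ?_⟩
  intro x hx
  have hx' : x ∈ w.support ∨ x = v := by simpa [SimpleGraph.Walk.support_concat] using hx
  exact hx'.elim (hS x) fun h => h ▸ hv

/-- Each step of a ball avoiding `W` gains the external neighbourhood, up to `W`. -/
lemma ncard_ballSetIn_succ [Finite V] (G : SimpleGraph V) (W Y : Set V) (r : ℕ) :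
    (ballSetIn G Wᶜ Y r).ncard + (extNbr G (ballSetIn G Wᶜ Y r)).ncard ≤
      (ballSetIn G Wᶜ Y (r + 1)).ncard + W.ncard := by
  have hdisj : Disjoint (ballSetIn G Wᶜ Y r) (extNbr G (ballSetIn G Wᶜ Y r)) :=
    Set.disjoint_left.2 fun v hv hv' => hv'.1 hv
  rw [← Set.ncard_union_eq hdisj (Set.toFinite _) (Set.toFinite _)]
  refine (Set.ncard_le_ncard ?_ (Set.toFinite _)).trans (Set.ncard_union_le _ _)
  rintro v (hv | ⟨-, u, hu, huv⟩)
  · exact Or.inl (ballSetIn_mono G _ _ r.le_succ hv)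
  · by_cases hW : v ∈ W
    · exact Or.inr hW
    · exact Or.inl (mem_ballSetIn_succ hu huv hW)

/-- The first step from a nonempty set avoiding `W` reaches at least the minimum degree,
up to `W`. -/
lemma MinDegGE.le_ncard_ballSetIn_one [Finite V] {G : SimpleGraph V} {δ : ℝ} (h : MinDegGE G δ)
    {W Y : Set V} (hY : Y ⊆ Wᶜ) (hne : Y.Nonempty) :
    δ ≤ (ballSetIn G Wᶜ Y 1).ncard + (W.ncard : ℝ) := by
  obtain ⟨y, hy⟩ := hne
  refine (h y).trans ?_
  norm_cast
  refine (Set.ncard_le_ncard ?_ (Set.toFinite _)).trans (Set.ncard_union_le _ _)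
  intro v hv
  by_cases hW : v ∈ W
  · exact Or.inr hW
  · exact Or.inl (mem_ballSetIn_succ (subset_ballSetIn G hY 0 hy) hv hW)

/-- On sets of size between `k / 2` and `n`, with `15 / k ≤ 1`, the expansion rate is at least
`ε₁ / log² n`. -/
lemma div_log_sq_le_epsFn {ε₁ k x n : ℝ} (hε₁ : 0 ≤ ε₁) (hk : 15 ≤ k) (hx : k / 2 ≤ x)
    (hxn : x ≤ n) : ε₁ / Real.log n ^ 2 ≤ epsFn ε₁ k x := by
  have hk0 : 0 < k := by linarith
  rw [epsFn, if_neg (by linarith)]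
  have h1 : 1 < 15 * x / k := by rw [lt_div_iff₀ hk0]; linarith
  have h2 : 15 * x / k ≤ n := by rw [div_le_iff₀ hk0]; nlinarith
  have h3 := Real.log_pos h1
  have h4 := Real.log_le_log (by linarith) h2
  gcongr

lemma exp_half_le_one_add {t : ℝ} (h0 : 0 ≤ t) (h1 : t ≤ 1) : Real.exp (t / 2) ≤ 1 + t := by
  rw [← Real.le_log_iff_exp_le (by linarith)]
  refine le_trans ?_ (Real.one_sub_inv_le_log_of_pos (by linarith))
  have : 1 - (1 + t)⁻¹ = t / (1 + t) := by field_simp; ring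
  rw [this]
  gcongr
  linarith

/-- In an expander of large minimum degree, a ball around `Y` that avoids a small set `W` covers
more than half of the vertices at radius of order `log³ n`. -/
lemma half_lt_ncard_ballSetIn [Finite V] {G : SimpleGraph V} {ε₁ ε₂ d x : ℝ} {n m : ℕ}
    (hn : Nat.card V = n) (hε₁ : 0 < ε₁) (hε₁' : ε₁ < 1) (hε₂' : ε₂ < 1)
    (hd : 15 ≤ ε₂ * d) (hd0 : 0 < d) (hL : 20 / ε₁ ≤ Real.log n) (hx : 1 ≤ x)
    (hG : IsExpander G ε₁ (ε₂ * d)) (hδ : MinDegGE G (d - 1))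
    {Y W : Set V} (hY : Y ⊆ Wᶜ) (hxY : x ≤ (Y.ncard : ℝ))
    (hW : (W.ncard : ℝ) * Real.log n ^ 3 ≤ 10 * x)
    (hm : 4 / ε₁ * Real.log n ^ 3 ≤ m) :
    (n : ℝ) / 2 < (ballSetIn G Wᶜ Y (m + 1)).ncard := by
  set L := Real.log n with hLdef
  have hL' : 20 ≤ L * ε₁ := by rwa [div_le_iff₀ hε₁] at hL
  have hL20 : 20 ≤ L := by nlinarith
  have hL0 : 0 < L := by linarith
  have hn0 : (0 : ℝ) < n := by
    rcases Nat.eq_zero_or_pos n with h | h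
    · simp [hLdef, h] at hL0
    · exact_mod_cast h
  have hcard : ∀ X : Set V, (X.ncard : ℝ) ≤ n := by
    intro X
    rw [← hn]
    exact_mod_cast Set.ncard_le_card X
  have hball : ∀ r, x ≤ ((ballSetIn G Wᶜ Y r).ncard : ℝ) := by
    intro r
    refine hxY.trans ?_
    exact_mod_cast Set.ncard_le_ncard (subset_ballSetIn G hY r) (Set.toFinite _)
  have hmono : ∀ {r s : ℕ}, r ≤ s →
      ((ballSetIn G Wᶜ Y r).ncard : ℝ) ≤ (ballSetIn G Wᶜ Y s).ncard := by
    intro r s h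
    exact_mod_cast Set.ncard_le_ncard (ballSetIn_mono G _ Y h) (Set.toFinite _)
  have hd15 : 15 ≤ d := by nlinarith
  have hkd : ε₂ * d ≤ d := by nlinarith
  have hone : ε₂ * d / 2 ≤ ((ballSetIn G Wᶜ Y 1).ncard : ℝ) := by
    rcases le_or_gt d (2 * x) with h | h
    · have := hball 1
      linarith
    · have hne : Y.Nonempty := by
        rw [← Set.ncard_pos]
        have : (0 : ℝ) < Y.ncard := by linarith
        exact_mod_cast this
      have h1 := hδ.le_ncard_ballSetIn_one hY hne
      have h2 : (100 : ℝ) ≤ L ^ 3 := by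
        calc (100 : ℝ) ≤ 20 ^ 3 := by norm_num
          _ ≤ L ^ 3 := by gcongr
      have h3 : (W.ncard : ℝ) * 100 ≤ W.ncard * L ^ 3 := by gcongr
      linarith
  set t := ε₁ / (2 * L ^ 2) with ht
  have ht0 : 0 ≤ t := by positivity
  have ht1 : t ≤ 1 := by
    rw [ht, div_le_one (by positivity)]
    nlinarith
  have hWt : ∀ r, (W.ncard : ℝ) ≤ t * (ballSetIn G Wᶜ Y r).ncard := by
    intro r
    have h1 : (W.ncard : ℝ) ≤ 10 * x / L ^ 3 := by rwa [le_div_iff₀ (by positivity)]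
    have h2 : 10 / L ^ 3 ≤ t := by
      rw [ht, div_le_div_iff₀ (by positivity) (by positivity)]
      nlinarith [sq_nonneg L]
    calc (W.ncard : ℝ) ≤ 10 / L ^ 3 * x := by rw [div_mul_eq_mul_div]; exact h1
      _ ≤ t * (ballSetIn G Wᶜ Y r).ncard := by gcongr; exact hball r
  by_contra hcon
  push Not at hcon
  have hgrow : ∀ i ≤ m, (1 + t) ^ i ≤ ((ballSetIn G Wᶜ Y (i + 1)).ncard : ℝ) := by
    intro i
    induction i with
    | zero => intro _; simpa using hx.trans (hball 1)
    | succ i ih =>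
      intro hi
      have hk2 := hone.trans (hmono (Nat.le_add_left 1 i))
      have hexp := hG _ hk2 (by
        rw [hn]
        exact (hmono (by omega)).trans hcon)
      have heps := div_log_sq_le_epsFn hε₁.le hd hk2 (hcard _)
      have hstep : ((ballSetIn G Wᶜ Y (i + 1)).ncard : ℝ) +
          (extNbr G (ballSetIn G Wᶜ Y (i + 1))).ncard ≤
          (ballSetIn G Wᶜ Y (i + 1 + 1)).ncard + W.ncard := by
        exact_mod_cast ncard_ballSetIn_succ G W Y (i + 1)
      have h2t : ε₁ / L ^ 2 = 2 * t := by rw [ht]; field_simp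
      rw [← hLdef, h2t] at heps
      have hmul := mul_le_mul_of_nonneg_right heps
        (Nat.cast_nonneg (α := ℝ) (ballSetIn G Wᶜ Y (i + 1)).ncard)
      have hWi := hWt (i + 1)
      calc (1 + t) ^ (i + 1) = (1 + t) ^ i * (1 + t) := pow_succ _ _
        _ ≤ (ballSetIn G Wᶜ Y (i + 1)).ncard * (1 + t) := by gcongr; exact ih (by omega)
        _ ≤ _ := by linarith
  have hbig : (n : ℝ) ≤ (1 + t) ^ m := by
    calc (n : ℝ) = Real.exp L := (Real.exp_log hn0).symm
      _ ≤ Real.exp (m * (t / 2)) := by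
        gcongr
        calc L = 4 / ε₁ * L ^ 3 * (t / 2) := by rw [ht]; field_simp; ring
          _ ≤ m * (t / 2) := by gcongr
      _ = Real.exp (t / 2) ^ m := Real.exp_nat_mul _ _
      _ ≤ (1 + t) ^ m := by gcongr; exact exp_half_le_one_add ht0 ht1
  linarith [hgrow m le_rfl]

/-- Balls around `A` and `B` that together exceed the vertex set give a path from `A` to `B`. -/
lemma exists_isPath_of_card_lt [Finite V] {G : SimpleGraph V} {S A B : Set V} {r s : ℕ}
    (h : Nat.card V < (ballSetIn G S A r).ncard + (ballSetIn G S B s).ncard) :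
    ∃ a b : V, a ∈ A ∧ b ∈ B ∧ ∃ w : G.Walk a b, w.IsPath ∧ w.length ≤ r + s ∧
      ∀ y ∈ w.support, y ∈ S := by
  classical
  have hnd : ¬ Disjoint (ballSetIn G S A r) (ballSetIn G S B s) := by
    intro hdisj
    have := Set.ncard_le_card (ballSetIn G S A r ∪ ballSetIn G S B s)
    rw [Set.ncard_union_eq hdisj (Set.toFinite _) (Set.toFinite _)] at this
    omega
  obtain ⟨v, ⟨a, ha, p, hp, hpS⟩, ⟨b, hb, q, hq, hqS⟩⟩ := Set.not_disjoint_iff.1 hnd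
  refine ⟨a, b, ha, hb, (p.append q.reverse).bypass, SimpleGraph.Walk.bypass_isPath _, ?_, ?_⟩
  · refine (SimpleGraph.Walk.length_bypass_le_length _).trans ?_
    simp only [SimpleGraph.Walk.length_append, SimpleGraph.Walk.length_reverse]
    omega
  · intro y hy
    have hy' := SimpleGraph.Walk.support_bypass_subset_support _ hy
    rw [SimpleGraph.Walk.mem_support_append_iff, SimpleGraph.Walk.support_reverse,
      List.mem_reverse] at hy'
    exact hy'.elim (hpS y) (hqS y)

/-- short connections in expanders avoiding a small set (Lemma 2.3). -/
theorem statement13 :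
    ∀ ε₁ ε₂ : ℝ, 0 < ε₁ → ε₁ < 1 → 0 < ε₂ → ε₂ < 1 →
      ∃ d₀ : ℝ, ∀ (n : ℕ) (d : ℝ), d₀ ≤ d → d ≤ n → ∀ x : ℝ, 1 ≤ x →
        ∀ (V : Type) [Fintype V] (G : SimpleGraph V), Nat.card V = n →
          IsExpander G ε₁ (ε₂ * d) → MinDegGE G (d - 1) →
            ∀ A B W : Set V, x ≤ (A.ncard : ℝ) → x ≤ (B.ncard : ℝ) →
              Disjoint W (A ∪ B) → (W.ncard : ℝ) * Real.log n ^ 3 ≤ 10 * x →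
                ∃ a b : V, a ∈ A ∧ b ∈ B ∧
                  ∃ w : G.Walk a b, w.IsPath ∧
                    (w.length : ℝ) ≤ 40 / ε₁ * Real.log n ^ 3 ∧
                    ∀ y ∈ w.support, y ∉ W := by
  intro ε₁ ε₂ hε₁ hε₁' hε₂ hε₂'
  refine ⟨max (Real.exp (20 / ε₁)) (15 / ε₂), ?_⟩
  intro n d hd hdn x hx V _ G hn hG hδ A B W hA hB hdisj hW
  have hd1 : Real.exp (20 / ε₁) ≤ d := (le_max_left _ _).trans hd
  have hd2 : 15 / ε₂ ≤ d := (le_max_right _ _).trans hd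
  have hd0 : 0 < d := (Real.exp_pos _).trans_le hd1
  have hk : 15 ≤ ε₂ * d := by rwa [div_le_iff₀' hε₂] at hd2
  have hL : 20 / ε₁ ≤ Real.log n :=
    (Real.le_log_iff_exp_le (hd0.trans_le hdn)).2 (hd1.trans hdn)
  set m := ⌈4 / ε₁ * Real.log n ^ 3⌉₊
  have hm : 4 / ε₁ * Real.log n ^ 3 ≤ m := Nat.le_ceil _
  obtain ⟨hWA, hWB⟩ := Set.disjoint_union_right.1 hdisj
  have hAhalf := half_lt_ncard_ballSetIn hn hε₁ hε₁' hε₂' hk hd0 hL hx hG hδ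
    hWA.symm.subset_compl_right hA hW hm
  have hBhalf := half_lt_ncard_ballSetIn hn hε₁ hε₁' hε₂' hk hd0 hL hx hG hδ
    hWB.symm.subset_compl_right hB hW hm
  have hlt : Nat.card V <
      (ballSetIn G Wᶜ A (m + 1)).ncard + (ballSetIn G Wᶜ B (m + 1)).ncard := by
    rw [hn, ← Nat.cast_lt (α := ℝ)]
    push_cast
    linarith
  obtain ⟨a, b, ha, hb, w, hw, hlen, hsupp⟩ := exists_isPath_of_card_lt hlt
  refine ⟨a, b, ha, hb, w, hw, ?_, hsupp⟩
  have hL1 : 1 ≤ Real.log n := by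
    refine le_trans ?_ hL
    rw [le_div_iff₀ hε₁]
    linarith
  have hpos : 1 ≤ 1 / ε₁ * Real.log n ^ 3 :=
    one_le_mul_of_one_le_of_one_le (by rw [le_div_iff₀ hε₁]; linarith) (one_le_pow₀ hL1)
  have hceil : (m : ℝ) < 4 / ε₁ * Real.log n ^ 3 + 1 := Nat.ceil_lt_add_one (by positivity)
  have hlen' : (w.length : ℝ) ≤ (m + 1) + (m + 1) := by exact_mod_cast hlen
  have h4 : 4 / ε₁ * Real.log n ^ 3 = 4 * (1 / ε₁ * Real.log n ^ 3) := by ring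
  have h40 : 40 / ε₁ * Real.log n ^ 3 = 40 * (1 / ε₁ * Real.log n ^ 3) := by ring
  linarith

end Balanced
end
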